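/- arXiv:1110.3495 — 10 statements merged into one kernel-verified Lean document; each statement's English description precedes it below -/
import Mathlib

section
/- Let n ≥ 1, let k₁,…,kₙ be mutually distinct positive real numbers and b₁,…,bₙ nonzero complex numbers, and let A, B(x,t), 𝕏(x,t) be the soliton data. Then for all (x,t) ∈ ℝ² the following three evolution equations hold: (i) ∂/∂x 𝕏(x,t) = B(x,t)·σ₂·B(x,t)*; (ii) ∂/∂t B(x,t) = i·A·∂/∂x B(x,t); (iii) ∂/∂t 𝕏(x,t) = i·A·B(x,t)·σ₂·B(x,t)* − i·B(x,t)·σ₂·B(x,t)*·A* + i·B(x,t)·γ·B(x,t)*. -/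
open Matrix Complex

noncomputable section

/-- The fixed 2×2 matrix σ₁ = [[0,1],[1,0]]. -/
def sigma1 : Matrix (Fin 2) (Fin 2) ℂ := !![0, 1; 1, 0]

/-- The fixed 2×2 matrix σ₂ = [[1,0],[0,0]]. -/
def sigma2 : Matrix (Fin 2) (Fin 2) ℂ := !![1, 0; 0, 0]

/-- The fixed 2×2 matrix γ = [[0,0],[0,i]]. -/
def gammaM : Matrix (Fin 2) (Fin 2) ℂ := !![0, 0; 0, Complex.I]

/-- The soliton matrix A = diag(−i k₁², …, −i kₙ²). -/
def solA (n : ℕ) (k : Fin n → ℝ) : Matrix (Fin n) (Fin n) ℂ :=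
  Matrix.diagonal fun j => -Complex.I * (k j : ℂ) ^ 2

/-- The soliton matrix B(x,t), whose j-th row is
`(e^{k_j x + k_j³ t} b_j , i k_j e^{k_j x + k_j³ t} b_j)`. -/
def solB (n : ℕ) (k : Fin n → ℝ) (b : Fin n → ℂ) (x t : ℝ) : Matrix (Fin n) (Fin 2) ℂ :=
  Matrix.of fun j => ![Complex.exp ((k j * x + (k j) ^ 3 * t : ℝ)) * b j,
    Complex.I * (k j : ℂ) * Complex.exp ((k j * x + (k j) ^ 3 * t : ℝ)) * b j]

/-- The soliton matrix 𝕏(x,t) = Iₙ + [ e^{(k_i+k_j)x+(k_i³+k_j³)t} b_i conj(b_j) / (k_i+k_j) ]. -/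
def solX (n : ℕ) (k : Fin n → ℝ) (b : Fin n → ℂ) (x t : ℝ) : Matrix (Fin n) (Fin n) ℂ :=
  1 + Matrix.of fun i j =>
    Complex.exp (((k i + k j) * x + ((k i) ^ 3 + (k j) ^ 3) * t : ℝ)) * b i *
      (starRingEnd ℂ) (b j) / ((k i : ℂ) + (k j : ℂ))

attribute [local instance] Matrix.normedAddCommGroup Matrix.normedSpace

theorem hasDerivAt_matrix_entries {m p : ℕ} (f : ℝ → Matrix (Fin m) (Fin p) ℂ)
    (f' : Matrix (Fin m) (Fin p) ℂ) (x : ℝ)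
    (h : ∀ i j, HasDerivAt (fun y => f y i j) (f' i j) x) : HasDerivAt f f' x := by
  have h2 : HasDerivAt (fun y => (f y : Fin m → Fin p → ℂ)) (f' : Fin m → Fin p → ℂ) x :=
    hasDerivAt_pi.2 fun i => hasDerivAt_pi.2 fun j => h i j
  exact h2

theorem hasDerivAt_exp_affine (a c x : ℝ) :
    HasDerivAt (fun y : ℝ => Complex.exp ((a * y + c : ℝ) : ℂ))
      ((a : ℂ) * Complex.exp ((a * x + c : ℝ) : ℂ)) x := by
  have h1 : HasDerivAt (fun y : ℝ => a * y + c) a x := by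
    simpa using ((hasDerivAt_id x).const_mul a).add_const c
  have h2 := h1.ofReal_comp.cexp
  rwa [mul_comm] at h2

theorem hasDerivAt_solB_x (n : ℕ) (k : Fin n → ℝ) (b : Fin n → ℂ) (x t : ℝ) :
    HasDerivAt (fun y => solB n k b y t)
      (Matrix.of fun i j => (k i : ℂ) * solB n k b x t i j) x := by
  apply hasDerivAt_matrix_entries
  intro i j
  have h := hasDerivAt_exp_affine (k i) (k i ^ 3 * t) x
  fin_cases j
  · simp only [solB, Matrix.of_apply]
    refine (h.mul_const (b i)).congr_deriv ?_
    simp [mul_assoc]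
  · simp only [solB, Matrix.of_apply]
    refine ((h.const_mul (Complex.I * (k i : ℂ))).mul_const (b i)).congr_deriv ?_
    simp
    ring

theorem hasDerivAt_solB_t (n : ℕ) (k : Fin n → ℝ) (b : Fin n → ℂ) (x t : ℝ) :
    HasDerivAt (fun y => solB n k b x y)
      (Matrix.of fun i j => (k i : ℂ) ^ 3 * solB n k b x t i j) t := by
  apply hasDerivAt_matrix_entries
  intro i j
  have h := hasDerivAt_exp_affine (k i ^ 3) (k i * x) t
  simp only [add_comm (_ * _ : ℝ) (k i * x)] at h
  fin_cases j
  · simp only [solB, Matrix.of_apply]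
    refine (h.mul_const (b i)).congr_deriv ?_
    simp [mul_assoc]
  · simp only [solB, Matrix.of_apply]
    refine ((h.const_mul (Complex.I * (k i : ℂ))).mul_const (b i)).congr_deriv ?_
    simp
    ring

theorem solB_sigma2_entry (n : ℕ) (k : Fin n → ℝ) (b : Fin n → ℂ) (x t : ℝ) (i j : Fin n) :
    (solB n k b x t * sigma2 * (solB n k b x t)ᴴ) i j =
      Complex.exp (((k i + k j) * x + ((k i) ^ 3 + (k j) ^ 3) * t : ℝ)) * b i *
      (starRingEnd ℂ) (b j) := by
  have e : (((k i + k j) * x + ((k i) ^ 3 + (k j) ^ 3) * t : ℝ) : ℂ) =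
      ((k i * x + k i ^ 3 * t : ℝ) : ℂ) + ((k j * x + k j ^ 3 * t : ℝ) : ℂ) := by
    push_cast; ring
  rw [e, Complex.exp_add]
  simp only [Matrix.mul_apply, Fin.sum_univ_two, solB, sigma2, Matrix.conjTranspose_apply,
    Matrix.of_apply, Matrix.cons_val_zero, Matrix.cons_val_one, Matrix.cons_val',
    Complex.star_def]
  simp [← Complex.exp_conj]
  ring

theorem solB_gammaM_entry (n : ℕ) (k : Fin n → ℝ) (b : Fin n → ℂ) (x t : ℝ) (i j : Fin n) :
    (solB n k b x t * gammaM * (solB n k b x t)ᴴ) i j =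
      Complex.I * (k i : ℂ) * (k j : ℂ) *
      (Complex.exp (((k i + k j) * x + ((k i) ^ 3 + (k j) ^ 3) * t : ℝ)) * b i *
      (starRingEnd ℂ) (b j)) := by
  have e : (((k i + k j) * x + ((k i) ^ 3 + (k j) ^ 3) * t : ℝ) : ℂ) =
      ((k i * x + k i ^ 3 * t : ℝ) : ℂ) + ((k j * x + k j ^ 3 * t : ℝ) : ℂ) := by
    push_cast; ring
  rw [e, Complex.exp_add]
  simp only [Matrix.mul_apply, Fin.sum_univ_two, solB, gammaM, Matrix.conjTranspose_apply,
    Matrix.of_apply, Matrix.cons_val_zero, Matrix.cons_val_one, Matrix.cons_val',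
    Complex.star_def]
  simp [← Complex.exp_conj]
  ring_nf
  simp only [Complex.I_pow_three]
  ring

/-- the three evolution equations
(i) `∂𝕏/∂x = B σ₂ B*`, (ii) `∂B/∂t = i A ∂B/∂x`,
(iii) `∂𝕏/∂t = i A B σ₂ B* − i B σ₂ B* A* + i B γ B*`
hold for the soliton data. -/
theorem soliton_evolution_equations (n : ℕ) (hn : 1 ≤ n) (k : Fin n → ℝ) (b : Fin n → ℂ)
    (hkpos : ∀ i, 0 < k i) (hkinj : Function.Injective k) (hb : ∀ i, b i ≠ 0) :
    ∀ x t : ℝ,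
      HasDerivAt (fun x' => solX n k b x' t)
        (solB n k b x t * sigma2 * (solB n k b x t)ᴴ) x ∧
      HasDerivAt (fun t' => solB n k b x t')
        (Complex.I • (solA n k * deriv (fun x' => solB n k b x' t) x)) t ∧
      HasDerivAt (fun t' => solX n k b x t')
        (Complex.I • (solA n k * solB n k b x t * sigma2 * (solB n k b x t)ᴴ)
          - Complex.I • (solB n k b x t * sigma2 * (solB n k b x t)ᴴ * (solA n k)ᴴ)
          + Complex.I • (solB n k b x t * gammaM * (solB n k b x t)ᴴ)) t := by
  intro x t
  have hne : ∀ i j, (k i : ℂ) + (k j : ℂ) ≠ 0 := by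
    intro i j
    have := add_pos (hkpos i) (hkpos j)
    exact_mod_cast this.ne'
  refine ⟨?_, ?_, ?_⟩
  · apply hasDerivAt_matrix_entries
    intro i j
    rw [solB_sigma2_entry]
    have h := hasDerivAt_exp_affine (k i + k j) ((k i ^ 3 + k j ^ 3) * t) x
    simp only [solX, Matrix.add_apply, Matrix.of_apply]
    refine ((((h.mul_const (b i)).mul_const ((starRingEnd ℂ) (b j))).div_const
      ((k i : ℂ) + (k j : ℂ))).const_add _).congr_deriv ?_
    rw [div_eq_iff (hne i j), Complex.ofReal_add (k i) (k j)]
    ring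
  · have hd : deriv (fun x' => solB n k b x' t) x =
        (Matrix.of fun i j => (k i : ℂ) * solB n k b x t i j) :=
      (hasDerivAt_solB_x n k b x t).deriv
    rw [hd]
    refine (hasDerivAt_solB_t n k b x t).congr_deriv ?_
    ext i j
    simp only [solA, Matrix.smul_apply, Matrix.diagonal_mul, Matrix.of_apply, smul_eq_mul]
    linear_combination (-(k i : ℂ) ^ 3 * solB n k b x t i j) * (-Complex.I_mul_I)
  · apply hasDerivAt_matrix_entries
    intro i j
    have h := hasDerivAt_exp_affine (k i ^ 3 + k j ^ 3) ((k i + k j) * x) t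
    simp only [add_comm (_ * _ : ℝ) ((k i + k j) * x)] at h
    simp only [solX, Matrix.add_apply, Matrix.of_apply]
    refine ((((h.mul_const (b i)).mul_const ((starRingEnd ℂ) (b j))).div_const
      ((k i : ℂ) + (k j : ℂ))).const_add _).congr_deriv ?_
    have hA : (solA n k)ᴴ = Matrix.diagonal fun j => Complex.I * (k j : ℂ) ^ 2 := by
      rw [solA, Matrix.diagonal_conjTranspose]
      congr 1
      ext j
      simp
    rw [hA, Matrix.mul_assoc (solA n k), Matrix.mul_assoc (solA n k)]
    simp only [Matrix.sub_apply, Matrix.smul_apply, smul_eq_mul, Matrix.mul_diagonal, solA,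
      Matrix.diagonal_mul, solB_sigma2_entry, solB_gammaM_entry]
    rw [div_eq_iff (hne i j), Complex.ofReal_add (k i ^ 3) (k j ^ 3)]
    generalize Complex.exp _ = E
    push_cast
    linear_combination ((k i : ℂ) ^ 2 + (k j : ℂ) ^ 2 - (k i : ℂ) * (k j : ℂ)) *
      ((k i : ℂ) + (k j : ℂ)) * E * b i * (starRingEnd ℂ) (b j) * Complex.I_mul_I

end
end

section
/- Let n ≥ 1, let k₁,…,kₙ be mutually distinct positive real numbers and b₁,…,bₙ nonzero complex numbers, and let 𝕏(x,t) be the soliton data matrix. Then for every (x,t) ∈ ℝ² the matrix 𝕏(x,t) is Hermitian positive definite; in particular 𝕏(x,t) is invertible and det 𝕏(x,t) is a strictly positive real number. -/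
open Matrix Complex
open scoped ComplexOrder

noncomputable section

/-- The Cauchy-type form `∑ w_i conj(w_j) / (k_i + k_j)` is nonnegative. -/
lemma cauchy_form_nonneg (n : ℕ) (k : Fin n → ℝ) (hkpos : ∀ i, 0 < k i) (w : Fin n → ℂ) :
    0 ≤ ∑ i, ∑ j, w i * (starRingEnd ℂ) (w j) / ((k i : ℂ) + (k j : ℂ)) := by
  have hre : ∀ i j, 0 < ((k i : ℂ) + (k j : ℂ)).re := fun i j => by
    simpa using add_pos (hkpos i) (hkpos j)
  have hint : ∀ i j, MeasureTheory.IntegrableOn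
      (fun s : ℝ => w i * (starRingEnd ℂ) (w j) * Complex.exp (((k i : ℂ) + (k j : ℂ)) * s))
      (Set.Iic 0) := fun i j =>
    (integrableOn_exp_mul_complex_Iic (hre i j) 0).const_mul _
  have key : ∑ i, ∑ j, w i * (starRingEnd ℂ) (w j) / ((k i : ℂ) + (k j : ℂ)) =
      ∫ s : ℝ in Set.Iic 0,
        ((Complex.normSq (∑ i, w i * Complex.exp ((k i * s : ℝ))) : ℝ) : ℂ) := by
    have h1 : ∀ s : ℝ, ((Complex.normSq (∑ i, w i * Complex.exp ((k i * s : ℝ))) : ℝ) : ℂ) =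
        ∑ i, ∑ j, w i * (starRingEnd ℂ) (w j) * Complex.exp (((k i : ℂ) + (k j : ℂ)) * s) := by
      intro s
      rw [← Complex.mul_conj, map_sum, Finset.sum_mul_sum]
      refine Finset.sum_congr rfl fun i _ => Finset.sum_congr rfl fun j _ => ?_
      rw [map_mul, ← Complex.exp_conj, Complex.conj_ofReal, add_mul, Complex.exp_add]
      push_cast
      ring
    simp_rw [h1]
    rw [MeasureTheory.integral_finsetSum _
      fun i _ => MeasureTheory.integrable_finsetSum _ fun j _ => hint i j]
    refine Finset.sum_congr rfl fun i _ => ?_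
    rw [MeasureTheory.integral_finsetSum _ fun j _ => hint i j]
    refine Finset.sum_congr rfl fun j _ => ?_
    rw [MeasureTheory.integral_const_mul, integral_exp_mul_complex_Iic (hre i j)]
    simp [div_eq_mul_inv]
  rw [key, integral_complex_ofReal]
  exact Complex.zero_le_real.mpr
    (MeasureTheory.integral_nonneg fun s => Complex.normSq_nonneg _)

/-- the soliton data matrix 𝕏(x,t) is Hermitian positive definite; in particular
it is invertible and its determinant is a strictly positive real number. -/
theorem soliton_X_posDef (n : ℕ) (hn : 1 ≤ n) (k : Fin n → ℝ) (b : Fin n → ℂ)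
    (hkpos : ∀ i, 0 < k i) (hkinj : Function.Injective k) (hb : ∀ i, b i ≠ 0) :
    ∀ x t : ℝ,
      (solX n k b x t).PosDef ∧ IsUnit (solX n k b x t) ∧
        (solX n k b x t).det.im = 0 ∧ 0 < (solX n k b x t).det.re := by
  intro x t
  have hpd : (solX n k b x t).PosDef := by
    refine Matrix.PosDef.add_posSemidef Matrix.PosDef.one ?_
    refine Matrix.PosSemidef.of_dotProduct_mulVec_nonneg ?_ fun y => ?_
    · ext i j
      simp only [Matrix.conjTranspose_apply, Matrix.of_apply, Complex.star_def, map_div₀, map_mul,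
        map_add, Complex.conj_conj, Complex.conj_ofReal, ← Complex.exp_conj]
      rw [add_comm (k j) (k i), add_comm (k j ^ 3) (k i ^ 3), add_comm (k j : ℂ) (k i : ℂ)]
      ring
    · have h := cauchy_form_nonneg n k hkpos
        (fun i => (starRingEnd ℂ) (y i) * (Complex.exp ((k i * x + (k i) ^ 3 * t : ℝ)) * b i))
      convert h using 1
      simp only [dotProduct, Matrix.mulVec, Finset.mul_sum, Matrix.of_apply, Pi.star_apply,
        Complex.star_def]
      refine Finset.sum_congr rfl fun i _ => Finset.sum_congr rfl fun j _ => ?_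
      rw [map_mul, map_mul, Complex.conj_conj, ← Complex.exp_conj, Complex.conj_ofReal]
      have he : Complex.exp (((k i + k j) * x + ((k i) ^ 3 + (k j) ^ 3) * t : ℝ)) =
          Complex.exp ((k i * x + (k i) ^ 3 * t : ℝ)) *
            Complex.exp ((k j * x + (k j) ^ 3 * t : ℝ)) := by
        rw [← Complex.exp_add]
        congr 1
        push_cast
        ring
      rw [he]
      ring
  have hd := Complex.pos_iff.mp hpd.det_pos
  exact ⟨hpd, hpd.isUnit, hd.2.symm, hd.1⟩

end
end

section
/- Let n ≥ 1, let k₁,…,kₙ be mutually distinct positive real numbers and b₁,…,bₙ nonzero complex numbers, and let 𝕏(x,t) be the soliton data matrix (which is positive definite for all (x,t), so τ(x,t) := det 𝕏(x,t) > 0). Then the function q(x,t) := −2·∂²/∂x² log τ(x,t) is a (real-valued, smooth) solution of the Korteweg–de Vries equation ∂q/∂t = −(3/2)·q·∂q/∂x + (1/4)·∂³q/∂x³ on ℝ²; that is, τ is the tau function of an n-soliton of the KdV equation. -/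
open Matrix Complex

noncomputable section

/-- The tau function τ(x,t) = det 𝕏(x,t) (a positive real number, taken via the real part). -/
def solTau (n : ℕ) (k : Fin n → ℝ) (b : Fin n → ℂ) (x t : ℝ) : ℝ :=
  ((solX n k b x t).det).re

/-- The n-soliton potential q(x,t) = −2 ∂²/∂x² log τ(x,t). -/
def solQ (n : ℕ) (k : Fin n → ℝ) (b : Fin n → ℂ) (x t : ℝ) : ℝ :=
  -2 * iteratedDeriv 2 (fun y => Real.log (solTau n k b y t)) x

namespace SolAux

open scoped ComplexOrder

/-- Entrywise differentiability of a matrix valued function. -/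
def HD {m n : Type} (M : ℝ → Matrix m n ℂ) (M' : Matrix m n ℂ) (s : ℝ) : Prop :=
  ∀ i j, HasDerivAt (fun s => M s i j) (M' i j) s

theorem HD.mul {m n p : Type} [Fintype n] {A : ℝ → Matrix m n ℂ} {B : ℝ → Matrix n p ℂ}
    {A' : Matrix m n ℂ} {B' : Matrix n p ℂ} {s : ℝ} (hA : HD A A' s) (hB : HD B B' s) :
    HD (fun s => A s * B s) (A' * B s + A s * B') s := by
  intro i j
  simp only [Matrix.add_apply, Matrix.mul_apply, ← Finset.sum_add_distrib]
  exact HasDerivAt.fun_sum fun l _ => (hA i l).mul (hB l j)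

theorem HD.const {m n : Type} (A : Matrix m n ℂ) (s : ℝ) : HD (fun _ => A) 0 s := by
  intro i j
  exact hasDerivAt_const _ _

theorem contDiff_det {n : Type} [Fintype n] [DecidableEq n] {V : Type*} [NormedAddCommGroup V]
    [NormedSpace ℝ V] {M : V → Matrix n n ℂ} (h : ∀ i j, ContDiff ℝ (⊤ : ℕ∞) (fun s => M s i j)) :
    ContDiff ℝ (⊤ : ℕ∞) (fun s => (M s).det) := by
  simp only [Matrix.det_apply']
  refine ContDiff.sum fun σ _ => contDiff_const.mul ?_
  exact contDiff_prod fun i _ => h _ _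

theorem contDiff_inv {n : Type} [Fintype n] [DecidableEq n] {V : Type*} [NormedAddCommGroup V]
    [NormedSpace ℝ V] {M : V → Matrix n n ℂ} (h : ∀ i j, ContDiff ℝ (⊤ : ℕ∞) (fun s => M s i j))
    (hd : ∀ s, (M s).det ≠ 0) (i j : n) :
    ContDiff ℝ (⊤ : ℕ∞) (fun s => (M s)⁻¹ i j) := by
  simp only [Matrix.inv_def, Ring.inverse_eq_inv', Matrix.smul_apply, smul_eq_mul,
    Matrix.adjugate_apply]
  refine ((contDiff_det h).inv hd).mul (contDiff_det fun a c => ?_)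
  by_cases hj : a = j
  · subst hj
    simp only [Matrix.updateRow_self]
    exact contDiff_const
  · simp only [Matrix.updateRow_ne hj]
    exact h a c

theorem hasDerivAt_det {n : Type} [Fintype n] [DecidableEq n] {M : ℝ → Matrix n n ℂ}
    {M' : Matrix n n ℂ} {s : ℝ} (h : HD M M' s) :
    HasDerivAt (fun s => (M s).det) ((M s).adjugate * M').trace s := by
  have h1 : HasDerivAt (fun s => (M s).det)
      (∑ σ : Equiv.Perm n, ((Equiv.Perm.sign σ : ℤ) : ℂ) *
        ∑ i, (∏ j ∈ Finset.univ.erase i, M s (σ j) j) • M' (σ i) i) s := by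
    simp only [Matrix.det_apply']
    refine HasDerivAt.fun_sum fun σ _ => HasDerivAt.const_mul _ ?_
    exact HasDerivAt.fun_finsetProd fun i _ => h (σ i) i
  convert h1 using 1
  have h2 : ∀ i, ((M s).adjugate * M') i i = ((M s).updateCol i (fun j => M' j i)).det := by
    intro i
    rw [← Matrix.cramer_apply, Matrix.cramer_eq_adjugate_mulVec]
    rfl
  simp only [Matrix.trace, Matrix.diag, h2, Matrix.det_apply']
  rw [Finset.sum_comm]
  refine Finset.sum_congr rfl fun σ _ => ?_
  rw [Finset.mul_sum]
  refine Finset.sum_congr rfl fun i _ => ?_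
  congr 1
  rw [← Finset.prod_erase_mul _ _ (Finset.mem_univ i), smul_eq_mul]
  congr 1
  · refine Finset.prod_congr rfl fun j hj => ?_
    rw [Matrix.updateCol_ne (Finset.ne_of_mem_erase hj)]
  · simp

theorem HD.inv {n : Type} [Fintype n] [DecidableEq n] {M : ℝ → Matrix n n ℂ}
    {M' : Matrix n n ℂ} {s : ℝ} (h : HD M M' s)
    (hs : ∀ i j, ContDiff ℝ (⊤ : ℕ∞) (fun s => M s i j)) (hd : ∀ s, (M s).det ≠ 0) :
    HD (fun s => (M s)⁻¹) (-((M s)⁻¹ * M' * (M s)⁻¹)) s := by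
  have h1 : HD (fun s => (M s)⁻¹) (Matrix.of fun i j => deriv (fun s => (M s)⁻¹ i j) s) s :=
    fun i j => (((contDiff_inv hs hd i j).differentiable (by simp)) s).hasDerivAt
  set D := (Matrix.of fun i j => deriv (fun s => (M s)⁻¹ i j) s) with hD
  have h2 := h1.mul h
  have hu : ∀ s, IsUnit (M s).det := fun s => isUnit_iff_ne_zero.mpr (hd s)
  have h3 : D * M s + (M s)⁻¹ * M' = 0 := by
    ext i j
    refine (h2 i j).unique ?_
    simp only [Matrix.nonsing_inv_mul _ (hu _)]
    exact hasDerivAt_const _ _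
  have h4 : D = -((M s)⁻¹ * M' * (M s)⁻¹) := by
    have : D * M s = -((M s)⁻¹ * M') := eq_neg_of_add_eq_zero_left h3
    calc D = D * M s * (M s)⁻¹ := by rw [Matrix.mul_assoc, Matrix.mul_nonsing_inv _ (hu s), Matrix.mul_one]
      _ = _ := by rw [this, Matrix.neg_mul]
  rw [← h4]
  exact h1

variable (n : ℕ) (k : Fin n → ℝ) (b : Fin n → ℂ)

/-- The diagonal matrix of the wave numbers. -/
def K : Matrix (Fin n) (Fin n) ℂ := Matrix.diagonal fun i => (k i : ℂ)

/-- Column vector of exponentials. -/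
def e (x t : ℝ) : Matrix (Fin n) Unit ℂ :=
  Matrix.of fun i _ => Complex.exp ((k i * x + k i ^ 3 * t : ℝ)) * b i

/-- The conjugate row vector. -/
def F (x t : ℝ) : Matrix Unit (Fin n) ℂ :=
  Matrix.of fun _ i => Complex.exp ((k i * x + k i ^ 3 * t : ℝ)) * (starRingEnd ℂ) (b i)

/-- The scalar products. -/
def w (p q : ℕ) (x t : ℝ) : ℂ :=
  (F n k b x t * K n k ^ p * (solX n k b x t)⁻¹ * K n k ^ q * e n k b x t) () ()

theorem F_eq (x t : ℝ) : F n k b x t = (e n k b x t)ᴴ := by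
  ext i j
  simp only [F, e, Matrix.of_apply, Matrix.conjTranspose_apply, star_mul', ← Complex.ofReal_exp,
    Complex.star_def, Complex.conj_ofReal]

theorem solX_apply (x t : ℝ) (i j : Fin n) : solX n k b x t i j = (1 : Matrix (Fin n) (Fin n) ℂ) i j +
    e n k b x t i () * F n k b x t () j / ((k i : ℂ) + k j) := by
  simp only [solX, e, F, Matrix.add_apply, Matrix.of_apply]
  have : Complex.exp (((k i + k j) * x + ((k i) ^ 3 + (k j) ^ 3) * t : ℝ)) =
    Complex.exp ((k i * x + k i ^ 3 * t : ℝ)) * Complex.exp ((k j * x + k j ^ 3 * t : ℝ)) := by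
    rw [← Complex.exp_add]
    congr 1
    push_cast
    ring
  rw [this]
  ring

theorem eF_apply (x t : ℝ) (i j : Fin n) :
    (e n k b x t * F n k b x t) i j = e n k b x t i () * F n k b x t () j := by
  simp [Matrix.mul_apply]

variable {k} (hk : ∀ i, 0 < k i)

theorem kne {n : ℕ} {k : Fin n → ℝ} (hk : ∀ i, 0 < k i) (i j : Fin n) : (k i : ℂ) + k j ≠ 0 := by
  have := add_pos (hk i) (hk j)
  exact_mod_cast this.ne'

include hk

theorem lyap (x t : ℝ) : K n k * solX n k b x t + solX n k b x t * K n k =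
    K n k + K n k + e n k b x t * F n k b x t := by
  ext i j
  have := kne hk i j
  simp only [K, Matrix.add_apply, Matrix.diagonal_mul, Matrix.mul_diagonal, eF_apply, solX_apply]
  by_cases h : i = j
  · subst h
    have h0 : (k i : ℂ) ≠ 0 := by exact_mod_cast (hk i).ne'
    simp
    field_simp
  · simp [h]
    field_simp

theorem lyap2 (x t : ℝ) : K n k ^ 2 * solX n k b x t - solX n k b x t * K n k ^ 2 =
    K n k * (e n k b x t * F n k b x t) - e n k b x t * F n k b x t * K n k := by
  ext i j
  have := kne hk i j
  simp only [K, Matrix.sub_apply, Matrix.diagonal_pow, Matrix.diagonal_mul, Matrix.mul_diagonal,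
    eF_apply, solX_apply]
  by_cases h : i = j
  · subst h
    simp
    ring
  · simp [h]
    field_simp
    ring

omit hk in
theorem solX_herm (x t : ℝ) : (solX n k b x t).IsHermitian := by
  ext i j
  have h1 : ∀ i, star (e n k b x t i ()) = F n k b x t () i := by
    intro i
    rw [F_eq]; rfl
  have h2 : ∀ i, star (F n k b x t () i) = e n k b x t i () := by
    intro i
    rw [← h1, star_star]
  rw [Matrix.conjTranspose_apply, solX_apply, solX_apply, star_add, star_div₀, star_mul', h1, h2]
  congr 1
  · rw [← Matrix.conjTranspose_apply, Matrix.conjTranspose_one]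
  · simp
    rw [mul_comm, add_comm]

theorem solX_pos (x t : ℝ) : (solX n k b x t).PosDef := by
  have hH := solX_herm n b (k := k) x t
  rw [hH.posDef_iff_eigenvalues_pos]
  intro i
  set v : Fin n → ℂ := (hH.eigenvectorBasis i : Fin n → ℂ) with hv
  have hev : solX n k b x t *ᵥ v = (hH.eigenvalues i : ℂ) • v := by
    have := hH.mulVec_eigenvectorBasis i
    simpa using this
  have hv0 : v ≠ 0 := by
    intro h0
    apply hH.eigenvectorBasis.orthonormal.ne_zero i
    ext j
    exact congrFun h0 j
  have hvx : star v ᵥ* solX n k b x t = (hH.eigenvalues i : ℂ) • star v := by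
    have := congrArg star hev
    rw [Matrix.star_mulVec, hH.eq] at this
    rw [this]
    ext j
    simp
  have hK : (K n k).PosDef := by
    rw [K, Matrix.posDef_diagonal_iff]
    intro j
    exact_mod_cast hk j
  have hE : (e n k b x t * F n k b x t).PosSemidef := by
    rw [F_eq]
    exact Matrix.posSemidef_self_mul_conjTranspose _
  have hKv := hK.dotProduct_mulVec_pos hv0
  have hEv := hE.dotProduct_mulVec_nonneg v
  have hl := congrArg (fun M : Matrix (Fin n) (Fin n) ℂ => star v ⬝ᵥ (M *ᵥ v)) (lyap n b hk x t)
  simp only [Matrix.add_mulVec, dotProduct_add, ← Matrix.mulVec_mulVec, hev] at hl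
  rw [Matrix.dotProduct_mulVec (star v) (solX n k b x t), hvx, Matrix.mulVec_smul, dotProduct_smul,
    smul_dotProduct, Matrix.mulVec_mulVec] at hl
  have hl' := congrArg Complex.re hl
  simp only [smul_eq_mul, Complex.add_re, Complex.re_ofReal_mul] at hl'
  have h1 := (Complex.pos_iff.mp hKv).1
  have h2 := (Complex.nonneg_iff.mp hEv).1
  by_contra hneg
  have := mul_nonneg (sub_nonneg.mpr (not_lt.mp hneg)) h1.le
  nlinarith

theorem det_ne (x t : ℝ) : (solX n k b x t).det ≠ 0 := (solX_pos n b hk x t).det_pos.ne'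

omit hk

theorem smooth_e (i : Fin n) (j : Unit) :
    ContDiff ℝ (⊤ : ℕ∞) (fun p : ℝ × ℝ => e n k b p.1 p.2 i j) := by
  simp only [e, Matrix.of_apply]
  refine ContDiff.mul (ContDiff.cexp ?_) contDiff_const
  exact Complex.ofRealCLM.contDiff.comp
    ((contDiff_const.mul contDiff_fst).add (contDiff_const.mul contDiff_snd))

theorem smooth_F (i : Unit) (j : Fin n) :
    ContDiff ℝ (⊤ : ℕ∞) (fun p : ℝ × ℝ => F n k b p.1 p.2 i j) := by
  simp only [F, Matrix.of_apply]
  refine ContDiff.mul (ContDiff.cexp ?_) contDiff_const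
  exact Complex.ofRealCLM.contDiff.comp
    ((contDiff_const.mul contDiff_fst).add (contDiff_const.mul contDiff_snd))

theorem smooth_X (i j : Fin n) :
    ContDiff ℝ (⊤ : ℕ∞) (fun p : ℝ × ℝ => solX n k b p.1 p.2 i j) := by
  simp only [solX_apply]
  exact contDiff_const.add (((smooth_e n b i ()).mul (smooth_F n b () j)).div_const _)

theorem smooth_mul {m n p : Type} [Fintype n] {A : ℝ × ℝ → Matrix m n ℂ}
    {B : ℝ × ℝ → Matrix n p ℂ}
    (hA : ∀ i j, ContDiff ℝ (⊤ : ℕ∞) (fun s => A s i j))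
    (hB : ∀ i j, ContDiff ℝ (⊤ : ℕ∞) (fun s => B s i j)) (i : m) (j : p) :
    ContDiff ℝ (⊤ : ℕ∞) (fun s => (A s * B s) i j) := by
  simp only [Matrix.mul_apply]
  exact ContDiff.sum fun l _ => (hA i l).mul (hB l j)

theorem smooth_w (hk : ∀ i, 0 < k i) (p q : ℕ) :
    ContDiff ℝ (⊤ : ℕ∞) (fun z : ℝ × ℝ => w n k b p q z.1 z.2) := by
  unfold w
  refine smooth_mul (smooth_mul (smooth_mul (smooth_mul (smooth_F n b) ?_) ?_) ?_) (smooth_e n b) _ _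
  · intro i j; exact contDiff_const
  · exact contDiff_inv (smooth_X n b) (fun z => det_ne n b hk z.1 z.2)
  · intro i j; exact contDiff_const

theorem phase_x (a c x t : ℝ) : HasDerivAt (fun y : ℝ => Complex.exp ((a * y + c * t : ℝ)))
    (a * Complex.exp ((a * x + c * t : ℝ))) x := by
  have h : HasDerivAt (fun y : ℝ => a * y + c * t) a x := by
    simpa using ((hasDerivAt_id x).const_mul a).add_const (c * t)
  simpa [mul_comm] using h.ofReal_comp.cexp

theorem phase_t (a c x t : ℝ) : HasDerivAt (fun s : ℝ => Complex.exp ((a * x + c * s : ℝ)))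
    (c * Complex.exp ((a * x + c * t : ℝ))) t := by
  have h : HasDerivAt (fun s : ℝ => a * x + c * s) c t := by
    simpa using ((hasDerivAt_id t).const_mul c).const_add (a * x)
  simpa [mul_comm] using h.ofReal_comp.cexp

theorem e_x (x t : ℝ) : HD (fun y => e n k b y t) (K n k * e n k b x t) x := by
  intro i j
  simp only [K, Matrix.diagonal_mul, e, Matrix.of_apply]
  rw [← mul_assoc]
  exact (phase_x _ _ x t).mul_const _

theorem e_t (x t : ℝ) : HD (fun s => e n k b x s) (K n k ^ 3 * e n k b x t) t := by
  intro i j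
  simp only [K, Matrix.diagonal_pow, Matrix.diagonal_mul, e, Matrix.of_apply]
  refine ((phase_t (k i) (k i ^ 3) x t).mul_const (b i)).congr_deriv ?_
  simp [mul_assoc]

theorem F_x (x t : ℝ) : HD (fun y => F n k b y t) (F n k b x t * K n k) x := by
  intro i j
  simp only [K, Matrix.mul_diagonal, F, Matrix.of_apply]
  refine ((phase_x (k j) (k j ^ 3) x t).mul_const _).congr_deriv ?_
  ring

theorem F_t (x t : ℝ) : HD (fun s => F n k b x s) (F n k b x t * K n k ^ 3) t := by
  intro i j
  simp only [K, Matrix.diagonal_pow, Matrix.mul_diagonal, F, Matrix.of_apply]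
  refine ((phase_t (k j) (k j ^ 3) x t).mul_const ((starRingEnd ℂ) (b j))).congr_deriv ?_
  simp only [Pi.pow_apply, Complex.ofReal_pow]
  ring

include hk

theorem X_x (x t : ℝ) : HD (fun y => solX n k b y t) (e n k b x t * F n k b x t) x := by
  intro i j
  have := kne hk i j
  simp only [solX_apply]
  have h := (((e_x n b (k := k) x t i ()).mul (F_x n b (k := k) x t () j)).div_const ((k i : ℂ) + k j)).const_add
    ((1 : Matrix (Fin n) (Fin n) ℂ) i j)
  refine h.congr_deriv ?_
  simp only [K, Matrix.mul_diagonal, Matrix.diagonal_mul, eF_apply]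
  field_simp

theorem X_t (x t : ℝ) : HD (fun s => solX n k b x s)
    (K n k ^ 2 * (e n k b x t * F n k b x t) - K n k * (e n k b x t * F n k b x t) * K n k
      + (e n k b x t * F n k b x t) * K n k ^ 2) t := by
  intro i j
  have := kne hk i j
  simp only [solX_apply]
  have h := (((e_t n b (k := k) x t i ()).mul (F_t n b (k := k) x t () j)).div_const ((k i : ℂ) + k j)).const_add
    ((1 : Matrix (Fin n) (Fin n) ℂ) i j)
  refine h.congr_deriv ?_
  simp only [K, Matrix.diagonal_pow, Matrix.mul_diagonal, Matrix.diagonal_mul, eF_apply,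
    Matrix.add_apply, Matrix.sub_apply, Pi.pow_apply]
  field_simp
  ring

theorem R_x (x t : ℝ) : HD (fun y => (solX n k b y t)⁻¹)
    (-((solX n k b x t)⁻¹ * (e n k b x t * F n k b x t) * (solX n k b x t)⁻¹)) x :=
  (X_x n b hk x t).inv
    (fun i j => ContDiff.comp (f := fun y : ℝ => (y, t)) (smooth_X n b i j)
      (contDiff_id.prodMk contDiff_const))
    (fun y => det_ne n b hk y t)

theorem R_t (x t : ℝ) : HD (fun s => (solX n k b x s)⁻¹)
    (-((solX n k b x t)⁻¹ * (K n k ^ 2 * (e n k b x t * F n k b x t)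
      - K n k * (e n k b x t * F n k b x t) * K n k
      + (e n k b x t * F n k b x t) * K n k ^ 2) * (solX n k b x t)⁻¹)) t :=
  (X_t n b hk x t).inv
    (fun i j => ContDiff.comp (f := fun s : ℝ => (x, s)) (smooth_X n b i j)
      (contDiff_const.prodMk contDiff_id))
    (fun y => det_ne n b hk x y)

omit hk in
theorem unit_mul (A B : Matrix Unit Unit ℂ) : A () () * B () () = (A * B) () () := by
  simp [Matrix.mul_apply]

theorem w_x (p q : ℕ) (x t : ℝ) : HasDerivAt (fun y => w n k b p q y t)
    (w n k b (p + 1) q x t + w n k b p (q + 1) x t - w n k b p 0 x t * w n k b 0 q x t) x := by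
  have h := ((((F_x n b (k := k) x t).mul (HD.const (K n k ^ p) x)).mul (R_x n b hk x t)).mul
    (HD.const (K n k ^ q) x)).mul (e_x n b (k := k) x t) () ()
  refine h.congr_deriv ?_
  simp only [w, unit_mul, ← Matrix.add_apply, ← Matrix.sub_apply]
  refine congrArg (fun M : Matrix Unit Unit ℂ => M () ()) ?_
  simp only [pow_succ' (K n k) p, pow_succ (K n k) q, pow_zero, Matrix.mul_add, Matrix.add_mul,
    Matrix.mul_one, Matrix.mul_zero, Matrix.zero_mul, Matrix.mul_neg, Matrix.neg_mul,
    Matrix.mul_assoc]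
  abel

theorem w_t (p q : ℕ) (x t : ℝ) : HasDerivAt (fun s => w n k b p q x s)
    (w n k b (p + 3) q x t + w n k b p (q + 3) x t - (w n k b p 2 x t * w n k b 0 q x t
      - w n k b p 1 x t * w n k b 1 q x t + w n k b p 0 x t * w n k b 2 q x t)) t := by
  have h := ((((F_t n b (k := k) x t).mul (HD.const (K n k ^ p) t)).mul (R_t n b hk x t)).mul
    (HD.const (K n k ^ q) t)).mul (e_t n b (k := k) x t) () ()
  refine h.congr_deriv ?_
  simp only [w, unit_mul, ← Matrix.add_apply, ← Matrix.sub_apply]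
  refine congrArg (fun M : Matrix Unit Unit ℂ => M () ()) ?_
  rw [add_comm p 3]
  simp only [pow_add, pow_one, pow_zero, Matrix.mul_add, Matrix.add_mul, Matrix.mul_sub,
    Matrix.sub_mul,
    Matrix.mul_one, Matrix.mul_zero, Matrix.zero_mul, Matrix.mul_neg, Matrix.neg_mul,
    Matrix.mul_assoc]
  abel

theorem w_rel (p q : ℕ) (x t : ℝ) : w n k b p (q + 2) x t = w n k b (p + 2) q x t +
    w n k b p 1 x t * w n k b 0 q x t - w n k b p 0 x t * w n k b 1 q x t := by
  have hu : IsUnit (solX n k b x t).det := isUnit_iff_ne_zero.mpr (det_ne n b hk x t)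
  have h := congrArg (fun M => (solX n k b x t)⁻¹ * M * (solX n k b x t)⁻¹) (lyap2 n b hk x t)
  have h' : (solX n k b x t)⁻¹ * K n k ^ 2 = K n k ^ 2 * (solX n k b x t)⁻¹ +
      (solX n k b x t)⁻¹ * (K n k * (e n k b x t * F n k b x t) -
        e n k b x t * F n k b x t * K n k) * (solX n k b x t)⁻¹ := by
    rw [← h]
    simp only [Matrix.mul_sub, Matrix.sub_mul]
    rw [← Matrix.mul_assoc (solX n k b x t)⁻¹ (solX n k b x t), Matrix.nonsing_inv_mul _ hu,
      Matrix.one_mul, Matrix.mul_assoc _ (_ * _) _, Matrix.mul_assoc (K n k ^ 2) (solX n k b x t),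
      Matrix.mul_nonsing_inv _ hu, Matrix.mul_one]
    abel
  simp only [w, unit_mul, ← Matrix.add_apply, ← Matrix.sub_apply]
  refine congrArg (fun M : Matrix Unit Unit ℂ => M () ()) ?_
  have : F n k b x t * K n k ^ p * (solX n k b x t)⁻¹ * K n k ^ (q + 2) * e n k b x t =
    F n k b x t * K n k ^ p * ((solX n k b x t)⁻¹ * K n k ^ 2) * K n k ^ q * e n k b x t := by
    rw [add_comm q 2, pow_add]
    simp only [Matrix.mul_assoc]
  rw [this, h', pow_add]
  simp only [pow_one, pow_zero, Matrix.mul_add, Matrix.add_mul, Matrix.mul_sub,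
    Matrix.sub_mul, Matrix.mul_one, Matrix.mul_assoc]
  abel

theorem det_x (x t : ℝ) : HasDerivAt (fun y => (solX n k b y t).det)
    ((solX n k b x t).det * w n k b 0 0 x t) x := by
  refine (hasDerivAt_det (X_x n b hk x t)).congr_deriv ?_
  have hu : IsUnit (solX n k b x t).det := isUnit_iff_ne_zero.mpr (det_ne n b hk x t)
  have h : (solX n k b x t).adjugate = (solX n k b x t).det • (solX n k b x t)⁻¹ := by
    rw [Matrix.inv_def, smul_smul, Ring.mul_inverse_cancel _ hu, one_smul]
  rw [h, Matrix.smul_mul, Matrix.trace_smul, smul_eq_mul, ← Matrix.mul_assoc, Matrix.trace_mul_comm]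
  simp [w, Matrix.trace, Matrix.mul_assoc]

theorem det_im (x t : ℝ) : ((solX n k b x t).det).im = 0 :=
  (Complex.pos_iff.mp (solX_pos n b hk x t).det_pos).2.symm

theorem tau_pos (x t : ℝ) : 0 < solTau n k b x t :=
  (Complex.pos_iff.mp (solX_pos n b hk x t).det_pos).1

omit hk in
theorem hasDerivAt_re {f : ℝ → ℂ} {f' : ℂ} {x : ℝ} (h : HasDerivAt f f' x) :
    HasDerivAt (fun y => (f y).re) f'.re x :=
  Complex.reCLM.hasFDerivAt.comp_hasDerivAt x h

omit hk in
theorem hasDerivAt_im {f : ℝ → ℂ} {f' : ℂ} {x : ℝ} (h : HasDerivAt f f' x) :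
    HasDerivAt (fun y => (f y).im) f'.im x :=
  Complex.imCLM.hasFDerivAt.comp_hasDerivAt x h

omit hk in
theorem im_zero {f : ℝ → ℂ} {f' : ℂ} {x : ℝ} (h : HasDerivAt f f' x) (hf : ∀ y, (f y).im = 0) :
    f'.im = 0 := by
  have h1 := hasDerivAt_im h
  simp only [hf] at h1
  exact h1.unique (hasDerivAt_const _ _)

theorem w_im (x t : ℝ) : (w n k b 0 0 x t).im = 0 := by
  have h := im_zero (det_x n b hk x t) (fun y => det_im n b hk y t)
  rw [Complex.mul_im, det_im n b hk, zero_mul, add_zero] at h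
  exact (mul_eq_zero.mp h).resolve_left (tau_pos n b hk x t).ne'

theorem log_x (x t : ℝ) : HasDerivAt (fun y => Real.log (solTau n k b y t))
    (w n k b 0 0 x t).re x := by
  have h := (hasDerivAt_re (det_x n b hk x t)).log (tau_pos n b hk x t).ne'
  refine h.congr_deriv ?_
  rw [Complex.mul_re, w_im n b hk, mul_zero, sub_zero]
  exact mul_div_cancel_left₀ _ (tau_pos n b hk x t).ne'

omit hk

variable (k)

/-- First derivative of `w 0 0`. -/
def P1 (x t : ℝ) : ℂ := w n k b 1 0 x t + w n k b 0 1 x t - w n k b 0 0 x t ^ 2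

/-- Second derivative of `w 0 0`. -/
def P2 (x t : ℝ) : ℂ := w n k b 2 0 x t + 2 * w n k b 1 1 x t + w n k b 0 2 x t
  - 3 * (w n k b 0 0 x t * (w n k b 1 0 x t + w n k b 0 1 x t)) + 2 * w n k b 0 0 x t ^ 3

/-- Third derivative of `w 0 0`. -/
def P3 (x t : ℝ) : ℂ := w n k b 3 0 x t + 3 * w n k b 2 1 x t + 3 * w n k b 1 2 x t
  + w n k b 0 3 x t - 4 * (w n k b 0 0 x t * (w n k b 2 0 x t + w n k b 0 2 x t))
  - 6 * (w n k b 0 0 x t * w n k b 1 1 x t) - 2 * (w n k b 1 0 x t * w n k b 0 1 x t)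
  - 3 * (w n k b 1 0 x t + w n k b 0 1 x t) ^ 2
  + 12 * (w n k b 0 0 x t ^ 2 * (w n k b 1 0 x t + w n k b 0 1 x t)) - 6 * w n k b 0 0 x t ^ 4

variable {k}

include hk

theorem P1_x (x t : ℝ) : HasDerivAt (fun y => P1 n k b y t) (P2 n k b x t) x := by
  have W := fun p q => w_x n b hk p q x t
  refine (((W 1 0).add (W 0 1)).sub ((W 0 0).pow 2)).congr_deriv ?_
  simp only [P2]
  norm_num
  ring

theorem P2_x (x t : ℝ) : HasDerivAt (fun y => P2 n k b y t) (P3 n k b x t) x := by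
  have W := fun p q => w_x n b hk p q x t
  refine (((((W 2 0).add ((W 1 1).const_mul 2)).add (W 0 2)).sub
    (((W 0 0).mul ((W 1 0).add (W 0 1))).const_mul 3)).add
    (((W 0 0).pow 3).const_mul 2)).congr_deriv ?_
  simp only [P3, Pi.add_apply]
  norm_num
  ring

theorem P_pde (x t : ℝ) : ∃ T Q : ℂ, HasDerivAt (fun s => P1 n k b x s) T t ∧
    HasDerivAt (fun y => P3 n k b y t) Q x ∧
    T = 1 / 4 * Q + 3 * P1 n k b x t * P2 n k b x t := by
  have W := fun p q => w_x n b hk p q x t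
  have V := fun p q => w_t n b hk p q x t
  refine ⟨_, _, ((V 1 0).add (V 0 1)).sub ((V 0 0).pow 2),
    ((((((((W 3 0).add ((W 2 1).const_mul 3)).add ((W 1 2).const_mul 3)).add (W 0 3)).sub
    (((W 0 0).mul ((W 2 0).add (W 0 2))).const_mul 4)).sub
    (((W 0 0).mul (W 1 1)).const_mul 6)).sub (((W 1 0).mul (W 0 1)).const_mul 2)).sub
    ((((W 1 0).add (W 0 1)).pow 2).const_mul 3)).add
    ((((W 0 0).pow 2).mul ((W 1 0).add (W 0 1))).const_mul 12) |>.sub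
    (((W 0 0).pow 4).const_mul 6), ?_⟩
  have r := fun p q => w_rel n b hk p q x t
  have r02 := r 0 0
  have r12 := r 1 0
  have r22 := r 2 0
  have r03 := r 0 1
  have r13 := r 1 1
  have r04 := r 0 2
  simp only [P1, P2, Pi.add_apply, Pi.pow_apply]
  norm_num at r02 r12 r22 r03 r13 r04 ⊢
  simp only [r04, r13, r03, r22, r12, r02]
  ring

theorem solQ_eq (x t : ℝ) : solQ n k b x t = -2 * (P1 n k b x t).re := by
  unfold solQ
  congr 1
  rw [iteratedDeriv_succ, iteratedDeriv_one]
  have h : deriv (fun y => Real.log (solTau n k b y t)) = fun y => (w n k b 0 0 y t).re :=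
    funext fun y => (log_x n b hk y t).deriv
  rw [h]
  refine ((hasDerivAt_re (w_x n b hk 0 0 x t)).congr_deriv ?_).deriv
  simp [P1, sq]

theorem P1_im (x t : ℝ) : (P1 n k b x t).im = 0 := by
  have h := im_zero (w_x n b hk 0 0 x t) (fun y => w_im n b hk y t)
  simpa [P1, sq] using h

theorem main : 
    (∀ x t : ℝ, 0 < solTau n k b x t ∧ ((solX n k b x t).det).im = 0) ∧
    ContDiff ℝ (⊤ : ℕ∞) (fun p : ℝ × ℝ => solQ n k b p.1 p.2) ∧
    (∀ x t : ℝ,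
      deriv (fun t' => solQ n k b x t') t =
        -(3 / 2) * solQ n k b x t * deriv (fun y => solQ n k b y t) x +
          (1 / 4) * iteratedDeriv 3 (fun y => solQ n k b y t) x) := by
  refine ⟨fun x t => ⟨tau_pos n b hk x t, det_im n b hk x t⟩, ?_, fun x t => ?_⟩
  · simp only [solQ_eq n b hk]
    refine contDiff_const.mul (Complex.reCLM.contDiff.comp
      (f := fun p : ℝ × ℝ => P1 n k b p.1 p.2) ?_)
    exact ((smooth_w n b hk 1 0).add (smooth_w n b hk 0 1)).sub ((smooth_w n b hk 0 0).pow 2)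
  · simp only [solQ_eq n b hk]
    obtain ⟨T, Q, hT, hQ, hTQ⟩ := P_pde n b hk x t
    have d1 : deriv (fun y => -2 * (P1 n k b y t).re) = fun y => -2 * (P2 n k b y t).re :=
      funext fun y => ((hasDerivAt_re (P1_x n b hk y t)).const_mul _).deriv
    have d2 : deriv (fun y => -2 * (P2 n k b y t).re) = fun y => -2 * (P3 n k b y t).re :=
      funext fun y => ((hasDerivAt_re (P2_x n b hk y t)).const_mul _).deriv
    rw [iteratedDeriv_succ, iteratedDeriv_succ, iteratedDeriv_one, d1, d2,
      ((hasDerivAt_re hQ).const_mul _).deriv, ((hasDerivAt_re hT).const_mul _).deriv, hTQ]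
    have hp := P1_im n b hk x t
    simp [Complex.add_re, Complex.mul_re, hp]
    ring

end SolAux

/-- τ(x,t) = det 𝕏(x,t) > 0, and q := −2 ∂²ₓ log τ is a real-valued smooth
solution of the KdV equation `q'_t = −(3/2) q q'_x + (1/4) q'''_xxx` on ℝ². -/
theorem soliton_tau_solves_KdV (n : ℕ) (hn : 1 ≤ n) (k : Fin n → ℝ) (b : Fin n → ℂ)
    (hkpos : ∀ i, 0 < k i) (hkinj : Function.Injective k) (hb : ∀ i, b i ≠ 0) :
    (∀ x t : ℝ, 0 < solTau n k b x t ∧ ((solX n k b x t).det).im = 0) ∧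
    ContDiff ℝ (⊤ : ℕ∞) (fun p : ℝ × ℝ => solQ n k b p.1 p.2) ∧
    (∀ x t : ℝ,
      deriv (fun t' => solQ n k b x t') t =
        -(3 / 2) * solQ n k b x t * deriv (fun y => solQ n k b y t) x +
          (1 / 4) * iteratedDeriv 3 (fun y => solQ n k b y t) x) := by
  exact SolAux.main n b hkpos

end
end

section
/- Let N ≥ 1, let A be a constant N×N complex matrix, and let B : ℝ² → (N×2 complex matrices) and 𝕏 : ℝ² → (N×N complex matrices) be infinitely differentiable, with 𝕏(x,t) Hermitian and invertible for all (x,t). Assume the KdV vessel conditions: (i) ∂/∂x (B σ₁) + A B σ₂ + B γ = 0; (ii) A 𝕏 + 𝕏 A* + B σ₁ B* = 0; (iii) ∂𝕏/∂x = B σ₂ B*; (iv) ∂B/∂t = i A ∂B/∂x; (v) ∂𝕏/∂t = i A B σ₂ B* − i B σ₂ B* A* + i B γ B*; and the normalization condition trace(σ₁ B* 𝕏⁻¹ B) = 0, all holding at every (x,t) ∈ ℝ². Define β(x,t) := −(B(x,t)* 𝕏(x,t)⁻¹ B(x,t))₁₁ (a real number, since B*𝕏⁻¹B is Hermitian). Then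 β satisfies 4·∂β/∂t = −6·(∂β/∂x)² + ∂³β/∂x³ on ℝ²; consequently q(x,t) := 2·∂β/∂x satisfies the KdV equation ∂q/∂t = −(3/2)·q·∂q/∂x + (1/4)·∂³q/∂x³. -/
open Matrix Complex

noncomputable section

attribute [local instance] Matrix.normedAddCommGroup Matrix.normedSpace

/-- Entrywise characterization of the derivative of a matrix function. -/
lemma kdv_hasDerivAt_iff {m n : Type} [Fintype m] [Fintype n]
    {f : ℝ → Matrix m n ℂ} {f' : Matrix m n ℂ} {x : ℝ} :
    HasDerivAt f f' x ↔ ∀ i j, HasDerivAt (fun y => f y i j) (f' i j) x := by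
  refine (hasDerivAt_pi (φ := f)).trans (forall_congr' fun i => ?_)
  exact hasDerivAt_pi (φ := fun y => f y i)

lemma kdv_hasDerivAt_mul {l m n : Type} [Fintype l] [Fintype m] [Fintype n]
    {f : ℝ → Matrix l m ℂ} {f' : Matrix l m ℂ} {g : ℝ → Matrix m n ℂ} {g' : Matrix m n ℂ} {x : ℝ}
    (hf : HasDerivAt f f' x) (hg : HasDerivAt g g' x) :
    HasDerivAt (fun y => f y * g y) (f' * g x + f x * g') x := by
  rw [kdv_hasDerivAt_iff] at *
  intro i j
  simp only [Matrix.mul_apply, Matrix.add_apply, ← Finset.sum_add_distrib]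
  exact HasDerivAt.fun_sum fun k _ => (hf i k).mul (hg k j)

lemma kdv_hasDerivAt_conjTranspose {m n : Type} [Fintype m] [Fintype n]
    {f : ℝ → Matrix m n ℂ} {f' : Matrix m n ℂ} {x : ℝ} (hf : HasDerivAt f f' x) :
    HasDerivAt (fun y => (f y)ᴴ) f'ᴴ x := by
  rw [kdv_hasDerivAt_iff] at *
  intro i j
  simp only [Matrix.conjTranspose_apply]
  exact (hf j i).star

lemma kdv_contDiff_iff {E : Type} [NormedAddCommGroup E] [NormedSpace ℝ E]
    {m n : Type} [Fintype m] [Fintype n] {k : WithTop ℕ∞}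
    {f : E → Matrix m n ℂ} :
    ContDiff ℝ k f ↔ ∀ i j, ContDiff ℝ k (fun y => f y i j) := by
  refine (contDiff_pi (Φ := f)).trans (forall_congr' fun i => ?_)
  exact contDiff_pi (Φ := fun y => f y i)

lemma kdv_contDiff_mul {E : Type} [NormedAddCommGroup E] [NormedSpace ℝ E]
    {l m n : Type} [Fintype l] [Fintype m] [Fintype n] {k : WithTop ℕ∞}
    {f : E → Matrix l m ℂ} {g : E → Matrix m n ℂ}
    (hf : ContDiff ℝ k f) (hg : ContDiff ℝ k g) :
    ContDiff ℝ k (fun y => f y * g y) := by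
  rw [kdv_contDiff_iff] at *
  intro i j
  simp only [Matrix.mul_apply]
  exact ContDiff.sum fun a _ => (hf i a).mul (hg a j)

lemma kdv_contDiff_conjTranspose {E : Type} [NormedAddCommGroup E] [NormedSpace ℝ E]
    {m n : Type} [Fintype m] [Fintype n] {k : WithTop ℕ∞}
    {f : E → Matrix m n ℂ} (hf : ContDiff ℝ k f) :
    ContDiff ℝ k (fun y => (f y)ᴴ) := by
  rw [kdv_contDiff_iff] at *
  intro i j
  simp only [Matrix.conjTranspose_apply]
  exact (Complex.conjCLE : ℂ ≃L[ℝ] ℂ).contDiff.comp (hf j i)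

lemma kdv_contDiff_det {E : Type} [NormedAddCommGroup E] [NormedSpace ℝ E]
    {n : Type} [Fintype n] [DecidableEq n] {k : WithTop ℕ∞}
    {f : E → Matrix n n ℂ} (hf : ContDiff ℝ k f) :
    ContDiff ℝ k (fun y => (f y).det) := by
  rw [kdv_contDiff_iff] at hf
  simp only [Matrix.det_apply']
  exact ContDiff.sum fun a _ => contDiff_const.mul (contDiff_prod fun i _ => hf _ _)

lemma kdv_contDiff_inv {E : Type} [NormedAddCommGroup E] [NormedSpace ℝ E]
    {n : Type} [Fintype n] [DecidableEq n] {k : WithTop ℕ∞}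
    {f : E → Matrix n n ℂ} (hf : ContDiff ℝ k f) (hu : ∀ y, IsUnit (f y)) :
    ContDiff ℝ k (fun y => (f y)⁻¹) := by
  have hd : ContDiff ℝ k (fun y => ((f y).det)⁻¹) :=
    (kdv_contDiff_det hf).inv fun y =>
      ((Matrix.isUnit_iff_isUnit_det _).1 (hu y)).ne_zero
  rw [kdv_contDiff_iff]
  intro i j
  simp only [Matrix.inv_def, Ring.inverse_eq_inv', Matrix.smul_apply, smul_eq_mul,
    Matrix.adjugate_apply]
  refine hd.mul (kdv_contDiff_det ?_)
  rw [kdv_contDiff_iff] at *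
  intro a b
  simp only [Matrix.updateRow_apply]
  split_ifs
  · exact contDiff_const
  · exact hf a b

lemma kdv_hasDerivAt_inv {n : Type} [Fintype n] [DecidableEq n]
    {f : ℝ → Matrix n n ℂ} {f' : Matrix n n ℂ} {x : ℝ} (hf : HasDerivAt f f' x)
    (hu : ∀ y, IsUnit (f y)) (hd : DifferentiableAt ℝ (fun y => (f y)⁻¹) x) :
    HasDerivAt (fun y => (f y)⁻¹) (-((f x)⁻¹ * f' * (f x)⁻¹)) x := by
  have hdet : ∀ y, IsUnit (f y).det := fun y => (Matrix.isUnit_iff_isUnit_det _).1 (hu y)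
  obtain ⟨g', h⟩ : ∃ g', HasDerivAt (fun y => (f y)⁻¹) g' x := ⟨_, hd.hasDerivAt⟩
  have hp := kdv_hasDerivAt_mul h hf
  have hc : (fun y => (f y)⁻¹ * f y) = fun _ => (1 : Matrix n n ℂ) := by
    funext y; exact Matrix.nonsing_inv_mul _ (hdet y)
  rw [hc] at hp
  have h0 := hp.unique (hasDerivAt_const x (1 : Matrix n n ℂ))
  have h1 : g' = -((f x)⁻¹ * f' * (f x)⁻¹) := by
    have h2 : (g' * f x + (f x)⁻¹ * f') * (f x)⁻¹ = 0 := by rw [h0, Matrix.zero_mul]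
    rw [Matrix.add_mul, Matrix.mul_assoc, Matrix.mul_nonsing_inv _ (hdet x), Matrix.mul_one] at h2
    exact eq_neg_of_add_eq_zero_left h2
  rw [← h1]; exact h

/-- Symmetry of mixed partial derivatives. -/
lemma kdv_mixed {f : ℝ × ℝ → ℂ} (hf : ContDiff ℝ (⊤ : ℕ∞) f) (x t : ℝ) :
    deriv (fun t' => deriv (fun y => f (y, t')) x) t
      = deriv (fun y => deriv (fun t' => f (y, t')) t) x := by
  have hd : Differentiable ℝ f := hf.differentiable (by simp)
  have hfd : ContDiff ℝ (⊤ : ℕ∞) (fderiv ℝ f) := hf.fderiv_right (by simp)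
  have hdd : Differentiable ℝ (fderiv ℝ f) := hfd.differentiable (by simp)
  have hx : ∀ a b : ℝ, HasDerivAt (fun y : ℝ => (y, b)) ((1 : ℝ), (0 : ℝ)) a := fun a b =>
    (hasDerivAt_id a).prodMk (hasDerivAt_const a b)
  have ht : ∀ a b : ℝ, HasDerivAt (fun y : ℝ => (a, y)) ((0 : ℝ), (1 : ℝ)) b := fun a b =>
    (hasDerivAt_const b a).prodMk (hasDerivAt_id b)
  have e1 : ∀ a b : ℝ, deriv (fun y => f (y, b)) a = fderiv ℝ f (a, b) (1, 0) := fun a b =>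
    ((hd (a, b)).hasFDerivAt.comp_hasDerivAt a (hx a b)).deriv
  have e2 : ∀ a b : ℝ, deriv (fun y => f (a, y)) b = fderiv ℝ f (a, b) (0, 1) := fun a b =>
    ((hd (a, b)).hasFDerivAt.comp_hasDerivAt b (ht a b)).deriv
  have d1 : ∀ v : ℝ × ℝ, HasDerivAt (fun b => fderiv ℝ f (x, b) v)
      (fderiv ℝ (fderiv ℝ f) (x, t) (0, 1) v) t := fun v => by
    have h := (hdd (x, t)).hasFDerivAt.comp_hasDerivAt t (ht x t)
    exact (ContinuousLinearMap.apply ℝ ℂ v).hasFDerivAt.comp_hasDerivAt t h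
  have d2 : ∀ v : ℝ × ℝ, HasDerivAt (fun a => fderiv ℝ f (a, t) v)
      (fderiv ℝ (fderiv ℝ f) (x, t) (1, 0) v) x := fun v => by
    have h := (hdd (x, t)).hasFDerivAt.comp_hasDerivAt x (hx x t)
    exact (ContinuousLinearMap.apply ℝ ℂ v).hasFDerivAt.comp_hasDerivAt x h
  have f1 : (fun t' => deriv (fun y => f (y, t')) x) = fun b => fderiv ℝ f (x, b) (1, 0) :=
    funext fun b => e1 x b
  have f2 : (fun y => deriv (fun t' => f (y, t')) t) = fun a => fderiv ℝ f (a, t) (0, 1) :=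
    funext fun a => e2 a t
  rw [f1, f2, (d1 _).deriv, (d2 _).deriv]
  have hs : IsSymmSndFDerivAt ℝ f (x, t) := hf.contDiffAt.isSymmSndFDerivAt
    (by rw [minSmoothness_of_isRCLikeNormedField]; exact WithTop.coe_le_coe.2 (le_top : (2 : ℕ∞) ≤ ⊤))
  exact hs _ _

/-- Algebra behind the `x`-derivative of `B* Y A^n B` (`Z` is the right factor). -/
lemma kdv_alg_x {N : ℕ} (A Y : Matrix (Fin N) (Fin N) ℂ) (B Z Z' : Matrix (Fin N) (Fin 2) ℂ)
    (P Q S1 S2 : Matrix (Fin 2) (Fin 2) ℂ)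
    (hAY : Aᴴ * Y = -(Y * A) - Y * B * S1 * Bᴴ * Y) :
    ((-(A * B * P + B * Q))ᴴ * Y + Bᴴ * (-(Y * (B * S2 * Bᴴ) * Y))) * Z + Bᴴ * Y * Z'
      = Pᴴ * (Bᴴ * Y * (A * Z)) + Pᴴ * (Bᴴ * Y * B) * S1 * (Bᴴ * Y * Z) - Qᴴ * (Bᴴ * Y * Z)
        - (Bᴴ * Y * B) * S2 * (Bᴴ * Y * Z) + Bᴴ * Y * Z' := by
  have h : ∀ W : Matrix (Fin N) (Fin 2) ℂ,
      Aᴴ * (Y * W) = -(Y * (A * W)) - Y * (B * (S1 * (Bᴴ * (Y * W)))) := by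
    intro W
    rw [← Matrix.mul_assoc, hAY]
    simp only [Matrix.sub_mul, Matrix.neg_mul, Matrix.mul_assoc]
  simp only [Matrix.conjTranspose_neg, Matrix.conjTranspose_add, Matrix.conjTranspose_mul,
    Matrix.add_mul, Matrix.mul_add, Matrix.neg_mul, Matrix.mul_neg, Matrix.mul_assoc, h,
    Matrix.mul_sub]
  abel

/-- Algebra behind the `t`-derivative of `B* Y B`. -/
lemma kdv_alg_t {N : ℕ} (A Y : Matrix (Fin N) (Fin N) ℂ) (B : Matrix (Fin N) (Fin 2) ℂ)
    (P Q S1 S2 G : Matrix (Fin 2) (Fin 2) ℂ)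
    (hAY : Aᴴ * Y = -(Y * A) - Y * B * S1 * Bᴴ * Y) :
    ((Complex.I • (A * -(A * B * P + B * Q)))ᴴ * Y
        + Bᴴ * (-(Y * (Complex.I • (A * B * S2 * Bᴴ) - Complex.I • (B * S2 * Bᴴ * Aᴴ)
          + Complex.I • (B * G * Bᴴ)) * Y))) * B
        + Bᴴ * Y * (Complex.I • (A * -(A * B * P + B * Q)))
      = Complex.I • (Pᴴ * (Bᴴ * Aᴴ * Aᴴ * Y * B)
        - Qᴴ * (Bᴴ * Y * (A * B)) - Qᴴ * (Bᴴ * Y * B) * S1 * (Bᴴ * Y * B)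
        - (Bᴴ * Y * (A * B)) * S2 * (Bᴴ * Y * B)
        - (Bᴴ * Y * B) * S2 * (Bᴴ * Y * (A * B))
        - (Bᴴ * Y * B) * S2 * (Bᴴ * Y * B) * S1 * (Bᴴ * Y * B)
        - (Bᴴ * Y * B) * G * (Bᴴ * Y * B)
        - (Bᴴ * Y * (A * (A * B))) * P - (Bᴴ * Y * (A * B)) * Q) := by
  have h : ∀ W : Matrix (Fin N) (Fin 2) ℂ,
      Aᴴ * (Y * W) = -(Y * (A * W)) - Y * (B * (S1 * (Bᴴ * (Y * W)))) := by
    intro W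
    rw [← Matrix.mul_assoc, hAY]
    simp only [Matrix.sub_mul, Matrix.neg_mul, Matrix.mul_assoc]
  have h' : Pᴴ * (Bᴴ * Aᴴ * Aᴴ * Y * B) = Pᴴ * (Bᴴ * (Aᴴ * (Aᴴ * (Y * B)))) := by
    simp only [Matrix.mul_assoc]
  rw [h']
  generalize hV : Pᴴ * (Bᴴ * (Aᴴ * (Aᴴ * (Y * B)))) = V
  simp only [Matrix.conjTranspose_neg, Matrix.conjTranspose_add, Matrix.conjTranspose_mul,
    Matrix.conjTranspose_smul, Matrix.smul_mul, Matrix.mul_smul,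
    Matrix.add_mul, Matrix.mul_add, Matrix.neg_mul, Matrix.mul_neg, Matrix.mul_assoc, hV,
    Matrix.mul_sub, Matrix.sub_mul, smul_add, smul_sub, smul_neg, Complex.star_def,
    Complex.conj_I, neg_smul]
  simp only [h, Matrix.mul_sub, Matrix.mul_neg, smul_sub, smul_neg, Matrix.mul_assoc]
  abel

set_option maxHeartbeats 4000000


/-- for a KdV evolutionary vessel, the linkage function
`β = −(B* 𝕏⁻¹ B)₁₁` is real and satisfies `4 β_t = −6 (β_x)² + β_xxx`; consequently
`q = 2 β_x` satisfies the KdV equation `q_t = −(3/2) q q_x + (1/4) q_xxx`. -/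
theorem vessel_beta_solves_KdV (N : ℕ) (hN : 1 ≤ N)
    (A : Matrix (Fin N) (Fin N) ℂ)
    (B : ℝ → ℝ → Matrix (Fin N) (Fin 2) ℂ)
    (X : ℝ → ℝ → Matrix (Fin N) (Fin N) ℂ)
    (hBsmooth : ContDiff ℝ (⊤ : ℕ∞) (fun p : ℝ × ℝ => B p.1 p.2))
    (hXsmooth : ContDiff ℝ (⊤ : ℕ∞) (fun p : ℝ × ℝ => X p.1 p.2))
    (hherm : ∀ x t, (X x t).IsHermitian)
    (hinv : ∀ x t, IsUnit (X x t))
    (h1 : ∀ x t, HasDerivAt (fun x' => B x' t * sigma1)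
      (-(A * B x t * sigma2 + B x t * gammaM)) x)
    (h2 : ∀ x t, A * X x t + X x t * Aᴴ + B x t * sigma1 * (B x t)ᴴ = 0)
    (h3 : ∀ x t, HasDerivAt (fun x' => X x' t) (B x t * sigma2 * (B x t)ᴴ) x)
    (h4 : ∀ x t, HasDerivAt (fun t' => B x t')
      (Complex.I • (A * deriv (fun x' => B x' t) x)) t)
    (h5 : ∀ x t, HasDerivAt (fun t' => X x t')
      (Complex.I • (A * B x t * sigma2 * (B x t)ᴴ)
        - Complex.I • (B x t * sigma2 * (B x t)ᴴ * Aᴴ)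
        + Complex.I • (B x t * gammaM * (B x t)ᴴ)) t)
    (hnorm : ∀ x t, Matrix.trace (sigma1 * (B x t)ᴴ * (X x t)⁻¹ * B x t) = 0)
    (β : ℝ → ℝ → ℂ)
    (hβ : ∀ x t, β x t = -(((B x t)ᴴ * (X x t)⁻¹ * B x t) 0 0))
    (q : ℝ → ℝ → ℂ)
    (hq : ∀ x t, q x t = 2 * deriv (fun y => β y t) x) :
    (∀ x t, (β x t).im = 0) ∧
    (∀ x t, 4 * deriv (fun t' => β x t') t =
        -6 * (deriv (fun y => β y t) x) ^ 2 + iteratedDeriv 3 (fun y => β y t) x) ∧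
    (∀ x t, deriv (fun t' => q x t') t =
        -(3 / 2) * q x t * deriv (fun y => q y t) x +
          (1 / 4) * iteratedDeriv 3 (fun y => q y t) x) := by
  have hdet : ∀ x t, IsUnit (X x t).det := fun x t => (Matrix.isUnit_iff_isUnit_det _).1 (hinv x t)
  have hYs : ContDiff ℝ (⊤ : ℕ∞) (fun p : ℝ × ℝ => (X p.1 p.2)⁻¹) :=
    kdv_contDiff_inv hXsmooth fun p => hinv p.1 p.2
  have hHs : ContDiff ℝ (⊤ : ℕ∞)
      (fun p : ℝ × ℝ => (B p.1 p.2)ᴴ * (X p.1 p.2)⁻¹ * B p.1 p.2) :=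
    kdv_contDiff_mul (kdv_contDiff_mul (kdv_contDiff_conjTranspose hBsmooth) hYs) hBsmooth
  have hβs : ContDiff ℝ (⊤ : ℕ∞) (fun p : ℝ × ℝ => β p.1 p.2) := by
    simp only [hβ]
    exact (kdv_contDiff_iff.1 hHs 0 0).neg
  have hx : ∀ a b : ℝ, DifferentiableAt ℝ (fun y : ℝ => (y, b)) a := fun a b => by fun_prop
  have ht : ∀ a b : ℝ, DifferentiableAt ℝ (fun y : ℝ => (a, y)) b := fun a b => by fun_prop
  have hYd : Differentiable ℝ (fun p : ℝ × ℝ => (X p.1 p.2)⁻¹) := hYs.differentiable (by simp)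
  have hYdx : ∀ x t, DifferentiableAt ℝ (fun y => (X y t)⁻¹) x := fun x t =>
    DifferentiableAt.comp (g := fun p : ℝ × ℝ => (X p.1 p.2)⁻¹) x (hYd (x, t)) (hx x t)
  have hYdt : ∀ x t, DifferentiableAt ℝ (fun y => (X x y)⁻¹) t := fun x t =>
    DifferentiableAt.comp (g := fun p : ℝ × ℝ => (X p.1 p.2)⁻¹) t (hYd (x, t)) (ht x t)
  have hYx : ∀ x t, HasDerivAt (fun y => (X y t)⁻¹)
      (-((X x t)⁻¹ * (B x t * sigma2 * (B x t)ᴴ) * (X x t)⁻¹)) x := fun x t =>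
    kdv_hasDerivAt_inv (h3 x t) (fun y => hinv y t) (hYdx x t)
  have hYt := fun x t =>
    kdv_hasDerivAt_inv (h5 x t) (fun y => hinv x y) (hYdt x t)
  have hss : sigma1 * sigma1 = 1 := by
    ext i j; fin_cases i <;> fin_cases j <;> simp [sigma1, Matrix.mul_apply]
  have hBx : ∀ x t, HasDerivAt (fun y => B y t)
      (-(A * B x t * (sigma2 * sigma1) + B x t * (gammaM * sigma1))) x := by
    intro x t
    have h := kdv_hasDerivAt_mul (h1 x t) (hasDerivAt_const x sigma1)
    simp only [Matrix.mul_assoc, hss, Matrix.mul_one, Matrix.mul_zero, add_zero] at h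
    simpa only [Matrix.mul_assoc, Matrix.neg_mul, Matrix.add_mul] using h
  have hBt : ∀ x t, HasDerivAt (fun y => B x y)
      (Complex.I • (A * -(A * B x t * (sigma2 * sigma1) + B x t * (gammaM * sigma1)))) t := by
    intro x t
    convert h4 x t using 3
    exact (hBx x t).deriv.symm
  have hAY : ∀ x t, Aᴴ * (X x t)⁻¹
      = -((X x t)⁻¹ * A) - (X x t)⁻¹ * B x t * sigma1 * (B x t)ᴴ * (X x t)⁻¹ := by
    intro x t
    have h : (X x t)⁻¹ * (A * X x t + X x t * Aᴴ + B x t * sigma1 * (B x t)ᴴ) * (X x t)⁻¹ = 0 := by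
      rw [h2]; simp
    have e1 : (X x t)⁻¹ * (A * X x t) * (X x t)⁻¹ = (X x t)⁻¹ * A := by
      rw [Matrix.mul_assoc, Matrix.mul_assoc, Matrix.mul_nonsing_inv _ (hdet x t), Matrix.mul_one]
    have e2 : (X x t)⁻¹ * (X x t * Aᴴ) * (X x t)⁻¹ = Aᴴ * (X x t)⁻¹ := by
      rw [← Matrix.mul_assoc, Matrix.nonsing_inv_mul _ (hdet x t), Matrix.one_mul]
    rw [Matrix.mul_add, Matrix.mul_add, Matrix.add_mul, Matrix.add_mul, e1, e2] at h
    have e3 : (X x t)⁻¹ * (B x t * sigma1 * (B x t)ᴴ) * (X x t)⁻¹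
      = (X x t)⁻¹ * B x t * sigma1 * (B x t)ᴴ * (X x t)⁻¹ := by
      simp only [Matrix.mul_assoc]
    rw [e3] at h
    rw [← sub_eq_zero, ← h]
    abel
  obtain ⟨H, hH⟩ : ∃ H : ℝ → ℝ → Matrix (Fin 2) (Fin 2) ℂ,
      ∀ x t, H x t = (B x t)ᴴ * (X x t)⁻¹ * B x t := ⟨_, fun _ _ => rfl⟩
  obtain ⟨K, hK⟩ : ∃ K : ℝ → ℝ → Matrix (Fin 2) (Fin 2) ℂ,
      ∀ x t, K x t = (B x t)ᴴ * (X x t)⁻¹ * (A * B x t) := ⟨_, fun _ _ => rfl⟩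
  obtain ⟨L, hL⟩ : ∃ L : ℝ → ℝ → Matrix (Fin 2) (Fin 2) ℂ,
      ∀ x t, L x t = (B x t)ᴴ * (X x t)⁻¹ * (A * (A * B x t)) := ⟨_, fun _ _ => rfl⟩
  obtain ⟨V, hV⟩ : ∃ V : ℝ → ℝ → Matrix (Fin 2) (Fin 2) ℂ,
      ∀ x t, V x t = (B x t)ᴴ * Aᴴ * Aᴴ * (X x t)⁻¹ * B x t := ⟨_, fun _ _ => rfl⟩
  have hHx : ∀ x t, HasDerivAt (fun y => H y t)
      ((sigma2 * sigma1)ᴴ * K x t + (sigma2 * sigma1)ᴴ * H x t * sigma1 * H x t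
        - (gammaM * sigma1)ᴴ * H x t - H x t * sigma2 * H x t
        + -(K x t * (sigma2 * sigma1) + H x t * (gammaM * sigma1))) x := by
    intro x t
    have h := kdv_hasDerivAt_mul (kdv_hasDerivAt_mul (kdv_hasDerivAt_conjTranspose (hBx x t))
      (hYx x t)) (hBx x t)
    rw [kdv_alg_x _ _ _ _ _ _ _ _ _ (hAY x t)] at h
    simp only [← hH, ← hK] at h
    convert h using 2
    rw [hH, hK]
    simp only [Matrix.mul_neg, Matrix.mul_add, Matrix.mul_assoc]
  have hKx : ∀ x t, HasDerivAt (fun y => K y t)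
      ((sigma2 * sigma1)ᴴ * L x t + (sigma2 * sigma1)ᴴ * H x t * sigma1 * K x t
        - (gammaM * sigma1)ᴴ * K x t - H x t * sigma2 * K x t
        + -(L x t * (sigma2 * sigma1) + K x t * (gammaM * sigma1))) x := by
    intro x t
    have h := kdv_hasDerivAt_mul (kdv_hasDerivAt_mul (kdv_hasDerivAt_conjTranspose (hBx x t))
      (hYx x t)) (kdv_hasDerivAt_mul (hasDerivAt_const x A) (hBx x t))
    rw [kdv_alg_x _ _ _ _ _ _ _ _ _ (hAY x t)] at h
    simp only [← hH, ← hK, ← hL] at h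
    convert h using 2
    rw [hL, hK]
    simp only [Matrix.mul_neg, Matrix.mul_add, Matrix.mul_assoc, Matrix.zero_mul, zero_add]
  have hHt : ∀ x t, HasDerivAt (fun y => H x y)
      (Complex.I • ((sigma2 * sigma1)ᴴ * V x t
        - (gammaM * sigma1)ᴴ * K x t - (gammaM * sigma1)ᴴ * H x t * sigma1 * H x t
        - K x t * sigma2 * H x t - H x t * sigma2 * K x t
        - H x t * sigma2 * H x t * sigma1 * H x t - H x t * gammaM * H x t
        - L x t * (sigma2 * sigma1) - K x t * (gammaM * sigma1))) t := by
    intro x t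
    have h := kdv_hasDerivAt_mul (kdv_hasDerivAt_mul (kdv_hasDerivAt_conjTranspose (hBt x t))
      (hYt x t)) (hBt x t)
    rw [kdv_alg_t _ _ _ _ _ _ _ _ (hAY x t)] at h
    simpa only [← hH, ← hK, ← hL, ← hV] using h
  have hn : ∀ x t, H x t 1 0 = - H x t 0 1 := by
    intro x t
    have h := hnorm x t
    rw [Matrix.mul_assoc, Matrix.mul_assoc, ← Matrix.mul_assoc _ _ (B x t), ← hH] at h
    simp only [sigma1, Matrix.trace, Matrix.diag_apply, Matrix.mul_apply, Fin.sum_univ_two] at h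
    simp at h
    exact eq_neg_of_add_eq_zero_left h
  have hβH : ∀ x t, β x t = - H x t 0 0 := fun x t => by rw [hβ, hH]
  have dβ : ∀ x t, HasDerivAt (fun y => β y t) ((β x t)^2 + 2 * I * H x t 0 1) x := by
    intro x t
    have h := (kdv_hasDerivAt_iff.1 (hHx x t) 0 0).neg
    simp only [hβH]
    refine HasDerivAt.congr_deriv (f := fun y => -H y t 0 0) h ?_
    symm
    simp [sigma1, sigma2, gammaM, Matrix.mul_apply, hn]
    ring
  have d01 : ∀ x t, HasDerivAt (fun y => H y t 0 1)
      (I * H x t 1 1 + β x t * H x t 0 1 - K x t 0 0) x := by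
    intro x t
    have h := kdv_hasDerivAt_iff.1 (hHx x t) 0 1
    convert h using 1
    simp [sigma1, sigma2, gammaM, Matrix.mul_apply, hn, hβH]
    ring
  have d11 : ∀ x t, HasDerivAt (fun y => H y t 1 1)
      (K x t 0 1 - K x t 1 0 - β x t * H x t 1 1 + 2 * (H x t 0 1)^2) x := by
    intro x t
    have h := kdv_hasDerivAt_iff.1 (hHx x t) 1 1
    convert h using 1
    simp [sigma1, sigma2, gammaM, Matrix.mul_apply, hn, hβH]
    ring
  have dK : ∀ x t, HasDerivAt (fun y => K y t 0 0)
      (I * (K x t 1 0 - K x t 0 1) + β x t * K x t 0 0) x := by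
    intro x t
    have h := kdv_hasDerivAt_iff.1 (hKx x t) 0 0
    convert h using 1
    simp [sigma1, sigma2, gammaM, Matrix.mul_apply, hn, hβH]
    ring
  have dt : ∀ x t, HasDerivAt (fun y => β x y)
      (K x t 1 0 - K x t 0 1 + 2 * (H x t 0 1)^2 - β x t * H x t 1 1
        - 2 * I * β x t * K x t 0 0) t := by
    intro x t
    have h := (kdv_hasDerivAt_iff.1 (hHt x t) 0 0).neg
    simp only [hβH]
    refine HasDerivAt.congr_deriv (f := fun y => -H x y 0 0) h ?_
    symm
    simp [sigma1, sigma2, gammaM, Matrix.mul_apply, hn]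
    linear_combination -(K x t 0 1 - K x t 1 0 - 2 * (H x t 0 1)^2 - H x t 0 0 * H x t 1 1) * I_sq
  have D1 : ∀ t, deriv (fun y => β y t) = fun y => (β y t)^2 + 2 * I * H y t 0 1 := fun t =>
    funext fun x => (dβ x t).deriv
  have D2 : ∀ t, deriv (deriv (fun y => β y t)) = fun x =>
      2 * β x t * ((β x t)^2 + 2 * I * H x t 0 1)
        + 2 * I * (I * H x t 1 1 + β x t * H x t 0 1 - K x t 0 0) := by
    intro t
    rw [D1]
    funext x
    have h := ((dβ x t).pow 2).add ((d01 x t).const_mul (2 * I))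
    refine Eq.trans (HasDerivAt.deriv (f := fun y => (β y t)^2 + 2 * I * H y t 0 1) h) ?_
    simp
  have hmain : ∀ x t, 4 * deriv (fun t' => β x t') t =
        -6 * (deriv (fun y => β y t) x) ^ 2 + iteratedDeriv 3 (fun y => β y t) x := by
    intro x t
    rw [iteratedDeriv_succ, iteratedDeriv_succ, iteratedDeriv_one, D2, D1, (dt x t).deriv]
    have h := (((dβ x t).const_mul 2).mul
      (((dβ x t).pow 2).add ((d01 x t).const_mul (2 * I)))).add
      (((((d11 x t).const_mul I).add ((dβ x t).mul (d01 x t))).sub (dK x t)).const_mul (2 * I))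
    have h' := h.deriv
    simp only [Pi.add_def, Pi.mul_def, Pi.sub_def, Pi.pow_def] at h'
    rw [h']
    simp only [Nat.cast_ofNat, Nat.add_one_sub_one, pow_one]
    linear_combination (4 * K x t 1 0 - 4 * K x t 0 1 + 8 * (H x t 0 1)^2 - 4 * β x t * H x t 1 1) * I_sq
  refine ⟨?_, hmain, ?_⟩
  · intro x t
    have hh : (H x t).IsHermitian := by
      rw [hH]
      exact Matrix.isHermitian_conjTranspose_mul_mul _ (hherm x t).inv
    have h := hh.apply 0 0
    rw [hβH, neg_im, neg_eq_zero]
    exact Complex.conj_eq_iff_im.1 h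
  · intro x t
    have hqf : ∀ t, (fun y => q y t) = fun y => 2 * deriv (fun y => β y t) y := fun t =>
      funext fun y => hq y t
    have hb : ContDiff ℝ (⊤ : ℕ∞) (fun y => β y t) :=
      hβs.comp (contDiff_id.prodMk contDiff_const)
    have hb1 : ContDiff ℝ (⊤ : ℕ∞) (deriv (fun y => β y t)) :=
      (contDiff_infty_iff_deriv.1 hb).2
    have hb2 : ContDiff ℝ (⊤ : ℕ∞) (deriv (deriv (fun y => β y t))) :=
      (contDiff_infty_iff_deriv.1 hb1).2
    have hb3 : ContDiff ℝ (⊤ : ℕ∞) (deriv (deriv (deriv (fun y => β y t)))) :=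
      (contDiff_infty_iff_deriv.1 hb2).2
    have b1 := (hb1.differentiable (by simp) x).hasDerivAt
    have b3 := (hb3.differentiable (by simp) x).hasDerivAt
    have e1 : deriv (fun t' => q x t') t = 2 * deriv (fun y => deriv (fun t' => β y t') t) x := by
      simp only [hq]
      rw [deriv_const_mul_field, ← kdv_mixed hβs x t]
    have e2 : (fun y => deriv (fun t' => β y t') t) = fun y => (1 / 4 : ℂ) *
        (-6 * (deriv (fun y => β y t) y) ^ 2 + deriv (deriv (deriv (fun y => β y t))) y) := by
      funext y
      have h := hmain y t
      rw [iteratedDeriv_succ, iteratedDeriv_succ, iteratedDeriv_one] at h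
      rw [← h]; ring
    have e3 : deriv (fun y => q y t) x = 2 * deriv (deriv (fun y => β y t)) x := by
      rw [hqf, deriv_const_mul_field]
    have e4 : iteratedDeriv 3 (fun y => q y t) x
        = 2 * deriv (deriv (deriv (deriv (fun y => β y t)))) x := by
      rw [hqf, iteratedDeriv_const_mul_field, iteratedDeriv_succ, iteratedDeriv_succ,
        iteratedDeriv_one]
    have h := ((((b1.pow 2).const_mul (-6)).add b3).const_mul (1 / 4 : ℂ)).deriv
    simp only [Pi.add_def, Pi.mul_def, Pi.pow_def] at h
    rw [e1, e2, h, e3, e4, hq]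
    simp only [Nat.cast_ofNat, Nat.add_one_sub_one, pow_one]
    ring

end
end

section
/- Let N ≥ 1, let A be a constant N×N complex matrix, and let B : ℝ² → (N×2 complex matrices) and 𝕏 : ℝ² → (N×N complex matrices) be continuously differentiable. Assume that for all (x,t) ∈ ℝ²: (i) ∂/∂x (B σ₁) + A B σ₂ + B γ = 0; (ii) ∂𝕏/∂x = B σ₂ B*; (iii) ∂B/∂t = i A ∂B/∂x; (iv) ∂𝕏/∂t = i A B σ₂ B* − i B σ₂ B* A* + i B γ B*. If the Lyapunov equation A 𝕏(0,0) + 𝕏(0,0) A* + B(0,0) σ₁ B(0,0)* = 0 holds at the point (0,0), then A 𝕏(x,t) + 𝕏(x,t) A* + B(x,t) σ₁ B(x,t)* = 0 holds for all (x,t) ∈ ℝ². -/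
open Matrix Complex

noncomputable section

attribute [local instance] Matrix.normedAddCommGroup Matrix.normedSpace

theorem hasDerivAt_mul_aux {l m n : ℕ} {P : ℝ → Matrix (Fin l) (Fin m) ℂ}
    {Q : ℝ → Matrix (Fin m) (Fin n) ℂ} {P' : Matrix (Fin l) (Fin m) ℂ}
    {Q' : Matrix (Fin m) (Fin n) ℂ} {x : ℝ}
    (hP : HasDerivAt P P' x) (hQ : HasDerivAt Q Q' x) :
    HasDerivAt (fun y => P y * Q y) (P' * Q x + P x * Q') x := by
  refine hasDerivAt_pi.2 fun i => hasDerivAt_pi.2 fun j => ?_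
  have hP' : ∀ k, HasDerivAt (fun y => P y i k) (P' i k) x := fun k =>
    hasDerivAt_pi.1 (hasDerivAt_pi.1 hP i) k
  have hQ' : ∀ k, HasDerivAt (fun y => Q y k j) (Q' k j) x := fun k =>
    hasDerivAt_pi.1 (hasDerivAt_pi.1 hQ k) j
  have := HasDerivAt.fun_sum (u := Finset.univ) fun k _ => (hP' k).mul (hQ' k)
  simpa [Matrix.mul_apply, Finset.sum_add_distrib] using this

theorem hasDerivAt_conjTranspose_aux {l m : ℕ} {P : ℝ → Matrix (Fin l) (Fin m) ℂ}
    {P' : Matrix (Fin l) (Fin m) ℂ} {x : ℝ} (hP : HasDerivAt P P' x) :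
    HasDerivAt (fun y => (P y)ᴴ) (P'ᴴ) x := by
  refine hasDerivAt_pi.2 fun i => hasDerivAt_pi.2 fun j => ?_
  exact (hasDerivAt_pi.1 (hasDerivAt_pi.1 hP j) i).star

theorem sigma1_sq : sigma1 * sigma1 = 1 := by
  ext i j; fin_cases i <;> fin_cases j <;> simp [sigma1, Matrix.mul_apply]

theorem sigma1_H : sigma1ᴴ = sigma1 := by
  ext i j; fin_cases i <;> fin_cases j <;> simp [sigma1]

theorem sigma2_H : sigma2ᴴ = sigma2 := by
  ext i j; fin_cases i <;> fin_cases j <;> simp [sigma2]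

theorem gammaM_H : gammaMᴴ = -gammaM := by
  ext i j; fin_cases i <;> fin_cases j <;> simp [gammaM]

/-- derivative of the Lyapunov expression along a curve -/
theorem lyap_deriv {N : ℕ} (A : Matrix (Fin N) (Fin N) ℂ)
    {b : ℝ → Matrix (Fin N) (Fin 2) ℂ} {y : ℝ → Matrix (Fin N) (Fin N) ℂ}
    {b' : Matrix (Fin N) (Fin 2) ℂ} {y' : Matrix (Fin N) (Fin N) ℂ} {s : ℝ}
    (hb : HasDerivAt b b' s) (hy : HasDerivAt y y' s)
    (h : A * y' + y' * Aᴴ + (b' * sigma1 * (b s)ᴴ + (b' * sigma1 * (b s)ᴴ)ᴴ) = 0) :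
    HasDerivAt (fun r => A * y r + y r * Aᴴ + b r * sigma1 * (b r)ᴴ) 0 s := by
  have k1 := hasDerivAt_mul_aux (hasDerivAt_const s A) hy
  have k2 := hasDerivAt_mul_aux hy (hasDerivAt_const s Aᴴ)
  have k3 := hasDerivAt_mul_aux (hasDerivAt_mul_aux hb (hasDerivAt_const s sigma1))
    (hasDerivAt_conjTranspose_aux hb)
  refine ((k1.add k2).add k3).congr_deriv ?_
  refine Eq.trans ?_ h
  simp [Matrix.conjTranspose_mul, sigma1_H, Matrix.mul_assoc]

theorem const_aux {N : ℕ} {f : ℝ → Matrix (Fin N) (Fin N) ℂ}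
    (h : ∀ s, HasDerivAt f 0 s) (a b : ℝ) : f a = f b :=
  is_const_of_deriv_eq_zero (fun s => (h s).differentiableAt) (fun s => (h s).deriv) a b

/-- if the vessel evolution equations hold everywhere and the Lyapunov equation
`A 𝕏 + 𝕏 A* + B σ₁ B* = 0` holds at the point (0,0), then it holds everywhere on ℝ². -/
theorem lyapunov_propagates (N : ℕ) (hN : 1 ≤ N)
    (A : Matrix (Fin N) (Fin N) ℂ)
    (B : ℝ → ℝ → Matrix (Fin N) (Fin 2) ℂ)
    (X : ℝ → ℝ → Matrix (Fin N) (Fin N) ℂ)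
    (hBsmooth : ContDiff ℝ 1 (fun p : ℝ × ℝ => B p.1 p.2))
    (hXsmooth : ContDiff ℝ 1 (fun p : ℝ × ℝ => X p.1 p.2))
    (h1 : ∀ x t, HasDerivAt (fun x' => B x' t * sigma1)
      (-(A * B x t * sigma2 + B x t * gammaM)) x)
    (h2 : ∀ x t, HasDerivAt (fun x' => X x' t) (B x t * sigma2 * (B x t)ᴴ) x)
    (h3 : ∀ x t, HasDerivAt (fun t' => B x t')
      (Complex.I • (A * deriv (fun x' => B x' t) x)) t)
    (h4 : ∀ x t, HasDerivAt (fun t' => X x t')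
      (Complex.I • (A * B x t * sigma2 * (B x t)ᴴ)
        - Complex.I • (B x t * sigma2 * (B x t)ᴴ * Aᴴ)
        + Complex.I • (B x t * gammaM * (B x t)ᴴ)) t)
    (h0 : A * X 0 0 + X 0 0 * Aᴴ + B 0 0 * sigma1 * (B 0 0)ᴴ = 0) :
    ∀ x t : ℝ, A * X x t + X x t * Aᴴ + B x t * sigma1 * (B x t)ᴴ = 0 := by
  have hBx : ∀ x t, HasDerivAt (fun x' => B x' t)
      (-(A * B x t * sigma2 + B x t * gammaM) * sigma1) x := by
    intro x t
    have := hasDerivAt_mul_aux (h1 x t) (hasDerivAt_const x sigma1)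
    simpa [Matrix.mul_assoc, sigma1_sq] using this
  have hx : ∀ x t, HasDerivAt
      (fun r => A * X r t + X r t * Aᴴ + B r t * sigma1 * (B r t)ᴴ) 0 x := by
    intro x t
    refine lyap_deriv A (hBx x t) (h2 x t) ?_
    have e : -(A * B x t * sigma2 + B x t * gammaM) * sigma1 * sigma1
        = -(A * B x t * sigma2 + B x t * gammaM) := by
      rw [Matrix.mul_assoc, sigma1_sq, Matrix.mul_one]
    rw [e]
    simp only [Matrix.mul_assoc, Matrix.neg_mul, Matrix.add_mul,
      Matrix.conjTranspose_mul, Matrix.conjTranspose_neg, Matrix.conjTranspose_add, sigma2_H,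
      gammaM_H, Matrix.conjTranspose_conjTranspose, Matrix.mul_neg]
    abel
  have ht : ∀ x t, HasDerivAt
      (fun r => A * X x r + X x r * Aᴴ + B x r * sigma1 * (B x r)ᴴ) 0 t := by
    intro x t
    refine lyap_deriv A (h3 x t) (h4 x t) ?_
    have e : Complex.I • (A * deriv (fun x' => B x' t) x) * sigma1
        = -(Complex.I • (A * (A * B x t * sigma2 + B x t * gammaM))) := by
      have hd : deriv (fun x' => B x' t) x
          = -(A * B x t * sigma2 + B x t * gammaM) * sigma1 := (hBx x t).deriv
      rw [hd, Matrix.smul_mul, Matrix.mul_assoc, Matrix.mul_assoc _ sigma1 sigma1, sigma1_sq,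
        Matrix.mul_one, Matrix.mul_neg, smul_neg]
    rw [e]
    simp only [Matrix.mul_assoc, Matrix.neg_mul, Matrix.add_mul, Matrix.sub_mul, Matrix.mul_sub,
      Matrix.conjTranspose_mul, Matrix.conjTranspose_neg, Matrix.conjTranspose_add, sigma2_H,
      gammaM_H, Matrix.conjTranspose_conjTranspose, Matrix.mul_neg, Matrix.mul_add,
      Matrix.conjTranspose_smul, Matrix.smul_mul, Matrix.mul_smul, smul_add, smul_neg,
      Complex.star_def, Complex.conj_I, neg_smul]
    abel
  intro x t
  rw [const_aux (fun s => hx s t) x 0, const_aux (fun s => ht 0 s) t 0]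
  exact h0

end
end

section
/- Let N ≥ 1, let A be an N×N complex matrix, 𝕏 an invertible Hermitian N×N complex matrix, and B an N×2 complex matrix, satisfying the Lyapunov equation A 𝕏 + 𝕏 A* + B σ₁ B* = 0. Define the transfer function S(λ) := I₂ − B* 𝕏⁻¹ (λ Iₙ − A)⁻¹ B σ₁. Then for every λ ∈ ℂ such that both λ Iₙ − A and −λ Iₙ − A* are invertible (i.e. neither λ nor −\overline{λ} is an eigenvalue of A), the symmetry condition (S(−\overline{λ}))* · σ₁ · S(λ) = σ₁ holds. -/
open Matrix Complex

noncomputable section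

/-- if `A 𝕏 + 𝕏 A* + B σ₁ B* = 0` with 𝕏 Hermitian and invertible, then the
transfer function `S(λ) = I − B* 𝕏⁻¹ (λI − A)⁻¹ B σ₁` satisfies the symmetry condition
`S(−λ̄)* σ₁ S(λ) = σ₁` whenever `λI − A` and `−λI − A*` are invertible. -/
theorem transfer_function_symmetry (N : ℕ) (hN : 1 ≤ N)
    (A X : Matrix (Fin N) (Fin N) ℂ) (B : Matrix (Fin N) (Fin 2) ℂ)
    (hherm : X.IsHermitian) (hinv : IsUnit X)
    (hLyap : A * X + X * Aᴴ + B * sigma1 * Bᴴ = 0)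
    (S : ℂ → Matrix (Fin 2) (Fin 2) ℂ)
    (hS : ∀ l : ℂ, S l = 1 - Bᴴ * X⁻¹ * (l • (1 : Matrix (Fin N) (Fin N) ℂ) - A)⁻¹ * B * sigma1) :
    ∀ l : ℂ, IsUnit (l • (1 : Matrix (Fin N) (Fin N) ℂ) - A) →
      IsUnit ((-l) • (1 : Matrix (Fin N) (Fin N) ℂ) - Aᴴ) →
      (S (-(starRingEnd ℂ l)))ᴴ * sigma1 * S l = sigma1 := by
  intro l hp hq
  set p := l • (1 : Matrix (Fin N) (Fin N) ℂ) - A with hpdef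
  set q := (-l) • (1 : Matrix (Fin N) (Fin N) ℂ) - Aᴴ with hqdef
  have hσ : sigma1ᴴ = sigma1 := by
    ext i j
    fin_cases i <;> fin_cases j <;> simp [sigma1]
  have hpq : ((-(starRingEnd ℂ l)) • (1 : Matrix (Fin N) (Fin N) ℂ) - A)ᴴ = q := by
    simp [hqdef, conjTranspose_sub, conjTranspose_smul]
  have hXd := (Matrix.isUnit_iff_isUnit_det X).1 hinv
  have hpd := (Matrix.isUnit_iff_isUnit_det p).1 hp
  have hqd := (Matrix.isUnit_iff_isUnit_det q).1 hq
  have hBB : B * sigma1 * Bᴴ = p * X + X * q := by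
    have h1 : p * X + X * q = -(A * X + X * Aᴴ) := by
      simp only [hpdef, hqdef, sub_mul, mul_sub, smul_mul_assoc, mul_smul_comm, one_mul, mul_one,
        neg_smul, mul_neg]
      abel
    rw [h1]
    exact eq_neg_of_add_eq_zero_right hLyap
  have key : q⁻¹ * X⁻¹ * (B * sigma1 * Bᴴ) * X⁻¹ * p⁻¹ = q⁻¹ * X⁻¹ + X⁻¹ * p⁻¹ := by
    rw [hBB]
    have e1 : q⁻¹ * X⁻¹ * (p * X) * X⁻¹ * p⁻¹ = q⁻¹ * X⁻¹ := by
      calc _ = q⁻¹ * X⁻¹ * (p * (X * X⁻¹) * p⁻¹) := by simp only [Matrix.mul_assoc]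
        _ = _ := by rw [mul_nonsing_inv X hXd, Matrix.mul_one, mul_nonsing_inv p hpd,
                      Matrix.mul_one]
    have e2 : q⁻¹ * X⁻¹ * (X * q) * X⁻¹ * p⁻¹ = X⁻¹ * p⁻¹ := by
      calc _ = (q⁻¹ * (X⁻¹ * X) * q) * (X⁻¹ * p⁻¹) := by simp only [Matrix.mul_assoc]
        _ = _ := by rw [nonsing_inv_mul X hXd, Matrix.mul_one, nonsing_inv_mul q hqd,
                      Matrix.one_mul]
    rw [Matrix.mul_add, Matrix.add_mul, Matrix.add_mul, e1, e2]
  have hS1 : (S (-(starRingEnd ℂ l)))ᴴ = 1 - sigma1 * Bᴴ * q⁻¹ * X⁻¹ * B := by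
    rw [hS]
    simp only [conjTranspose_sub, conjTranspose_one, conjTranspose_mul,
      conjTranspose_conjTranspose, hσ]
    rw [conjTranspose_nonsing_inv, conjTranspose_nonsing_inv, hpq, hherm.eq]
    simp only [Matrix.mul_assoc]
  rw [hS1, hS]
  have hk : sigma1 * Bᴴ * q⁻¹ * X⁻¹ * B * sigma1 * (Bᴴ * X⁻¹ * p⁻¹ * B * sigma1)
      = sigma1 * Bᴴ * q⁻¹ * X⁻¹ * B * sigma1 + sigma1 * (Bᴴ * X⁻¹ * p⁻¹ * B * sigma1) := by
    calc _ = sigma1 * Bᴴ * (q⁻¹ * X⁻¹ * (B * sigma1 * Bᴴ) * X⁻¹ * p⁻¹) * (B * sigma1) := by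
          simp only [Matrix.mul_assoc]
      _ = _ := by
          rw [key, Matrix.mul_add, Matrix.add_mul]
          simp only [Matrix.mul_assoc]
  rw [Matrix.sub_mul, Matrix.one_mul, Matrix.mul_sub, Matrix.mul_one, Matrix.sub_mul, hk]
  abel

end
end

section
/- Let λ ∈ ℂ, let β : ℝ → ℝ be differentiable, and define γ_*(x) := [[−i(β'(x) − β(x)²), −β(x)], [β(x), i]]. Let y = (y₁, y₂) : ℝ → ℂ² be differentiable. Then y satisfies the output compatibility equation λ σ₂ y(x) − σ₁ y'(x) + γ_*(x) y(x) = 0 for all x if and only if y₁ is twice differentiable with −y₁''(x) + 2 β'(x) y₁(x) = −i λ y₁(x) and y₂(x) = −i (y₁'(x) − β(x) y₁(x)) for all x. In particular, the output equation is equivalent to the Sturm–Liouville equation with potential q(x) = 2 β'(x). -/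
open Matrix Complex

noncomputable section

/-- a differentiable `y = (y₁,y₂)` satisfies the output compatibility equation
`λσ₂y − σ₁y' + γ_*y = 0`, with `γ_*(x) = [[−i(β'(x)−β(x)²), −β(x)],[β(x), i]]`, iff `y₁` is
twice differentiable, satisfies the Sturm–Liouville equation `−y₁'' + 2β' y₁ = −iλ y₁`
(with potential `q = 2β'`), and `y₂ = −i(y₁' − β y₁)`. -/
theorem output_equation_iff_SL (l : ℂ) (β : ℝ → ℝ) (hβ : Differentiable ℝ β)
    (gammaStar : ℝ → Matrix (Fin 2) (Fin 2) ℂ)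
    (hgs : ∀ x, gammaStar x =
      !![-Complex.I * (((deriv β x : ℝ) : ℂ) - (β x : ℂ) ^ 2), -(β x : ℂ); (β x : ℂ), Complex.I])
    (y : ℝ → Fin 2 → ℂ) (hy : Differentiable ℝ y) :
    (∀ x, l • sigma2.mulVec (y x) - sigma1.mulVec (deriv y x) + (gammaStar x).mulVec (y x) = 0) ↔
      (Differentiable ℝ (deriv fun s => y s 0) ∧
        (∀ x, -(deriv (deriv fun s => y s 0) x) + 2 * ((deriv β x : ℝ) : ℂ) * y x 0
          = -Complex.I * l * y x 0) ∧
        (∀ x, y x 1 = -Complex.I * (deriv (fun s => y s 0) x - (β x : ℂ) * y x 0))) := by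
  have hc : ∀ i x, HasDerivAt (fun s => y s i) (deriv y x i) x := fun i x =>
    (hasDerivAt_pi.1 (hy x).hasDerivAt) i
  have hb : ∀ x, HasDerivAt (fun s => (β s : ℂ)) ((deriv β x : ℝ) : ℂ) x := fun x =>
    (hβ x).hasDerivAt.ofReal_comp
  have hd0 : ∀ x, deriv (fun s => y s 0) x = deriv y x 0 := fun x => (hc 0 x).deriv
  have hI : Complex.I * Complex.I = -1 := Complex.I_mul_I
  have key : ∀ x, (l • sigma2.mulVec (y x) - sigma1.mulVec (deriv y x)
      + (gammaStar x).mulVec (y x) = 0) ↔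
      (l * y x 0 - deriv y x 1 + (-Complex.I * (((deriv β x : ℝ) : ℂ) - (β x : ℂ) ^ 2) * y x 0
        + -(β x : ℂ) * y x 1) = 0 ∧
       - deriv y x 0 + ((β x : ℂ) * y x 0 + Complex.I * y x 1) = 0) := by
    intro x
    rw [hgs x, funext_iff, Fin.forall_fin_two]
    simp [sigma1, sigma2, Matrix.mulVec, dotProduct, Fin.sum_univ_two]
  constructor
  · intro h
    have h0 := fun x => ((key x).1 (h x)).1
    have h1 := fun x => ((key x).1 (h x)).2
    have hfun : (deriv fun s => y s 0)
        = fun x => (β x : ℂ) * y x 0 + Complex.I * y x 1 := by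
      funext x
      rw [hd0]
      linear_combination -(h1 x)
    have hD : ∀ x, HasDerivAt (deriv fun s => y s 0)
        (((deriv β x : ℝ) : ℂ) * y x 0 + (β x : ℂ) * deriv y x 0
          + Complex.I * deriv y x 1) x := by
      intro x
      rw [hfun]
      exact ((hb x).mul (hc 0 x)).add ((hc 1 x).const_mul Complex.I)
    refine ⟨fun x => (hD x).differentiableAt, fun x => ?_, fun x => ?_⟩
    · rw [(hD x).deriv]
      linear_combination (Complex.I) * h0 x + (β x : ℂ) * h1 x
        + (((deriv β x : ℝ) : ℂ) - (β x : ℂ) ^ 2) * y x 0 * hI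
    · rw [hd0]
      linear_combination (-Complex.I) * h1 x + y x 1 * hI
  · rintro ⟨hdd, hsl, hy1⟩ x
    rw [key]
    have hfun : (fun s => y s 1)
        = fun x => -Complex.I * (deriv (fun s => y s 0) x - (β x : ℂ) * y x 0) := funext hy1
    have hD : HasDerivAt (fun s => y s 1)
        (-Complex.I * (deriv (deriv fun s => y s 0) x
          - (((deriv β x : ℝ) : ℂ) * y x 0 + (β x : ℂ) * deriv y x 0))) x := by
      rw [hfun]
      exact ((hdd x).hasDerivAt.sub ((hb x).mul (hc 0 x))).const_mul _
    have e := (hc 1 x).unique hD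
    have s := hsl x
    have q := hy1 x
    rw [hd0] at q
    constructor
    · linear_combination (-Complex.I) * s - e - (β x : ℂ) * q + l * y x 0 * hI
    · linear_combination Complex.I * q - (deriv y x 0 - (β x : ℂ) * y x 0) * hI

end
end

section
/- Let N ≥ 1, let B : ℝ → (N×2 complex matrices) be continuous and let 𝕏 : ℝ → (N×N complex matrices) be differentiable with d𝕏/dx (x) = B(x) σ₂ B(x)* and 𝕏(x) invertible for all x. Fix x₀ ∈ ℝ and define the tau function τ(x) := det(𝕏(x₀)⁻¹ 𝕏(x)). Then τ is differentiable and τ'(x)/τ(x) = trace(σ₂ B(x)* 𝕏(x)⁻¹ B(x)) for all x, where trace is the trace of a 2×2 matrix. -/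
open Matrix Complex

noncomputable section

attribute [local instance] Matrix.normedAddCommGroup Matrix.normedSpace

theorem hasDerivAt_det_aux (N : ℕ) (X : ℝ → Matrix (Fin N) (Fin N) ℂ)
    (D : Matrix (Fin N) (Fin N) ℂ) (x : ℝ)
    (h : ∀ i j, HasDerivAt (fun y => X y i j) (D i j) x) :
    HasDerivAt (fun y => (X y).det) (((X x).adjugate * D).trace) x := by
  have key : ((X x).adjugate * D).trace =
      ∑ σ : Equiv.Perm (Fin N), ((Equiv.Perm.sign σ : ℤ) : ℂ) *
        ∑ i, (∏ j ∈ Finset.univ.erase i, X x (σ j) j) • D (σ i) i := by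
    have h1 : ∀ i, ((X x).adjugate * D) i i = ((X x).updateCol i (fun k => D k i)).det := by
      intro i
      rw [← Matrix.cramer_apply, Matrix.cramer_eq_adjugate_mulVec]
      rfl
    simp only [Matrix.trace, Matrix.diag, h1, Matrix.det_apply', Finset.mul_sum]
    rw [Finset.sum_comm]
    refine Finset.sum_congr rfl fun σ _ => Finset.sum_congr rfl fun i _ => ?_
    congr 1
    rw [← Finset.prod_erase_mul _ _ (Finset.mem_univ i), smul_eq_mul]
    congr 1
    · refine Finset.prod_congr rfl fun j hj => ?_
      rw [Matrix.updateCol_ne (Finset.ne_of_mem_erase hj)]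
    · simp
  rw [key]
  simp only [Matrix.det_apply']
  refine HasDerivAt.fun_sum fun σ _ => ?_
  refine HasDerivAt.const_mul _ ?_
  exact HasDerivAt.fun_finsetProd fun i _ => h (σ i) i

/-- the tau function `τ(x) = det(𝕏(x₀)⁻¹ 𝕏(x))` is differentiable with
logarithmic derivative `τ'/τ = trace(σ₂ B* 𝕏⁻¹ B)`. -/
theorem tau_log_derivative (N : ℕ) (hN : 1 ≤ N)
    (B : ℝ → Matrix (Fin N) (Fin 2) ℂ) (hB : Continuous B)
    (X : ℝ → Matrix (Fin N) (Fin N) ℂ)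
    (hX : ∀ x, HasDerivAt X (B x * sigma2 * (B x)ᴴ) x)
    (hinv : ∀ x, IsUnit (X x))
    (x₀ : ℝ) (τ : ℝ → ℂ) (hτ : ∀ x, τ x = ((X x₀)⁻¹ * X x).det) :
    ∀ x, HasDerivAt τ (Matrix.trace (sigma2 * (B x)ᴴ * (X x)⁻¹ * B x) * τ x) x := by
  intro x
  have hent : ∀ i j, HasDerivAt (fun y => X y i j) ((B x * sigma2 * (B x)ᴴ) i j) x := by
    intro i j
    exact hasDerivAt_pi.1 (hasDerivAt_pi.1 (hX x) i) j
  have hd := (hasDerivAt_det_aux N X _ x hent).const_mul ((X x₀)⁻¹.det)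
  have hτ' : τ = fun y => (X x₀)⁻¹.det * (X y).det := by
    funext y
    rw [hτ, Matrix.det_mul]
  have hu : (X x).det ≠ 0 := ((Matrix.isUnit_iff_isUnit_det _).1 (hinv x)).ne_zero
  have hadj : (X x).adjugate = (X x).det • (X x)⁻¹ := by
    rw [Matrix.inv_def, smul_smul, Ring.inverse_eq_inv', mul_inv_cancel₀ hu, one_smul]
  have ht : Matrix.trace (sigma2 * (B x)ᴴ * (X x)⁻¹ * B x) =
      ((X x)⁻¹ * (B x * sigma2 * (B x)ᴴ)).trace := by
    rw [Matrix.mul_assoc _ (X x)⁻¹, Matrix.trace_mul_comm]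
    simp only [Matrix.mul_assoc]
  rw [hτ', ht]
  refine HasDerivAt.congr_deriv hd ?_
  rw [hadj, Matrix.smul_mul, Matrix.trace_smul, smul_eq_mul]
  ring

end
end

section
/- Let N ≥ 1, fix x₀ ∈ ℝ, let B : ℝ → (N×2 complex matrices) be continuous, let 𝕏₀ be an invertible N×N complex matrix, and define 𝕏(x) := 𝕏₀ + ∫_{x₀}^{x} B(s) σ₂ B(s)* ds; assume 𝕏(x) is invertible for all x in an interval I containing x₀. Define Ω(x,y) := (B(x)* 𝕏₀⁻¹ B(y))₁₁ and K(x,y) := −(B(x)* 𝕏(x)⁻¹ B(y))₁₁, where (·)₁₁ denotes the top-left entry of a 2×2 matrix. Then the Gelfand–Levitan equation K(x,y) + Ω(x,y) + ∫_{x₀}^{x} K(x,s) Ω(s,y) ds = 0 holds for all x, y ∈ I. -/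
open Matrix Complex intervalIntegral

noncomputable section

/-- the Gelfand–Levitan equation
`K(x,y) + Ω(x,y) + ∫_{x₀}^{x} K(x,s) Ω(s,y) ds = 0` holds, where
`Ω(x,y) = (B(x)* 𝕏₀⁻¹ B(y))₁₁` and `K(x,y) = −(B(x)* 𝕏(x)⁻¹ B(y))₁₁` with
`𝕏(x) = 𝕏₀ + ∫_{x₀}^{x} B(s) σ₂ B(s)* ds`. -/
theorem gelfand_levitan (N : ℕ) (hN : 1 ≤ N) (x₀ : ℝ)
    (B : ℝ → Matrix (Fin N) (Fin 2) ℂ) (hB : Continuous B)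
    (X₀ : Matrix (Fin N) (Fin N) ℂ) (hX₀ : IsUnit X₀)
    (X : ℝ → Matrix (Fin N) (Fin N) ℂ)
    (hX : ∀ x, X x = X₀ + Matrix.of fun i j => ∫ s in x₀..x, (B s * sigma2 * (B s)ᴴ) i j)
    (I : Set ℝ) (hIoc : Set.OrdConnected I) (hx₀I : x₀ ∈ I)
    (hinv : ∀ x ∈ I, IsUnit (X x))
    (Ω K : ℝ → ℝ → ℂ)
    (hΩ : ∀ x y, Ω x y = ((B x)ᴴ * X₀⁻¹ * B y) 0 0)
    (hK : ∀ x y, K x y = -(((B x)ᴴ * (X x)⁻¹ * B y) 0 0)) :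
    ∀ x ∈ I, ∀ y ∈ I, K x y + Ω x y + ∫ s in x₀..x, K x s * Ω s y = 0 := by
  intro x hx y _
  have hXx := hinv x hx
  set u : Fin N → ℂ := fun i => ((B x)ᴴ * (X x)⁻¹) 0 i with hu
  set v : Fin N → ℂ := fun j => (X₀⁻¹ * B y) j 0 with hv
  have hent : ∀ i k, Continuous fun s => B s i k := fun i k =>
    (continuous_apply k).comp ((continuous_apply i).comp hB)
  have hG : ∀ s i j, (B s * sigma2 * (B s)ᴴ) i j = B s i 0 * star (B s j 0) := by
    intro s i j
    simp [Matrix.mul_apply, sigma2, Fin.sum_univ_two]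
  have hint : ∀ s, K x s * Ω s y
      = ∑ i, ∑ j, -(u i * v j) * (B s * sigma2 * (B s)ᴴ) i j := by
    intro s
    have h1 : K x s = -∑ i, u i * B s i 0 := by
      rw [hK, Matrix.mul_apply]
    have h2 : Ω s y = ∑ j, star (B s j 0) * v j := by
      rw [hΩ, Matrix.mul_assoc, Matrix.mul_apply]
      rfl
    rw [h1, h2, neg_mul, Finset.sum_mul_sum, ← Finset.sum_neg_distrib]
    refine Finset.sum_congr rfl fun i _ => ?_
    rw [← Finset.sum_neg_distrib]
    refine Finset.sum_congr rfl fun j _ => ?_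
    rw [hG]
    ring
  have hcont : ∀ i j, Continuous fun s => -(u i * v j) * (B s * sigma2 * (B s)ᴴ) i j := by
    intro i j
    simp only [hG]
    exact continuous_const.mul ((hent i 0).mul (hent j 0).star)
  have hI : ∫ s in x₀..x, K x s * Ω s y = ∑ i, ∑ j, -(u i * v j) * (X x - X₀) i j := by
    simp only [hint]
    rw [intervalIntegral.integral_finsetSum fun i _ =>
      (continuous_finsetSum _ fun j _ => hcont i j).intervalIntegrable _ _]
    refine Finset.sum_congr rfl fun i _ => ?_
    rw [intervalIntegral.integral_finsetSum fun j _ => (hcont i j).intervalIntegrable _ _]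
    refine Finset.sum_congr rfl fun j _ => ?_
    rw [intervalIntegral.integral_const_mul, hX x]
    simp
  have hS : ∑ i, ∑ j, -(u i * v j) * (X x - X₀) i j
      = -((((B x)ᴴ * (X x)⁻¹) * (X x - X₀) * (X₀⁻¹ * B y)) 0 0) := by
    simp only [Matrix.mul_apply (N := X₀⁻¹ * B y), Matrix.mul_apply (N := X x - X₀)]
    simp only [Finset.sum_mul]
    rw [Finset.sum_comm, ← Finset.sum_neg_distrib]
    refine Finset.sum_congr rfl fun j _ => ?_
    rw [← Finset.sum_neg_distrib]
    refine Finset.sum_congr rfl fun i _ => ?_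
    simp only [hu, hv]
    ring
  have e1 : (X x)⁻¹ * X x = 1 :=
    Matrix.nonsing_inv_mul _ ((Matrix.isUnit_iff_isUnit_det _).1 hXx)
  have e2 : X₀ * X₀⁻¹ = 1 :=
    Matrix.mul_nonsing_inv _ ((Matrix.isUnit_iff_isUnit_det _).1 hX₀)
  have hM : ((B x)ᴴ * (X x)⁻¹) * (X x - X₀) * (X₀⁻¹ * B y)
      = (B x)ᴴ * X₀⁻¹ * B y - (B x)ᴴ * (X x)⁻¹ * B y := by
    rw [Matrix.mul_sub, Matrix.sub_mul, Matrix.mul_assoc (B x)ᴴ _ (X x), e1, Matrix.mul_one,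
      Matrix.mul_assoc _ X₀, ← Matrix.mul_assoc X₀, e2, Matrix.one_mul, ← Matrix.mul_assoc]
  rw [hI, hS, hM, hK, hΩ, Matrix.sub_apply]
  ring

end
end

section
/- Let N ≥ 1, let A be a constant N×N complex matrix, and let B : ℝ → (N×2 complex matrices) and 𝕏 : ℝ → (N×N complex matrices) be continuously differentiable, with 𝕏(x) Hermitian and invertible for all x, satisfying for all x: (i) d/dx (B σ₁) + A B σ₂ + B γ = 0; (ii) A 𝕏 + 𝕏 A* + B σ₁ B* = 0; (iii) d𝕏/dx = B σ₂ B*. Define β(x) := −(B(x)* 𝕏(x)⁻¹ B(x))₁₁, where (·)₁₁ denotes the top-left entry of a 2×2 matrix. Then β is differentiable and β'(x) = trace( [[0, −i],[i, 0]] · B(x)* 𝕏(x)⁻¹ B(x) ) + β(x)² for all x, where trace is the trace of a 2×2 matrix. -/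
open Matrix Complex

noncomputable section

section InvDeriv

attribute [local instance] Matrix.linftyOpNormedRing Matrix.linftyOpNormedAlgebra

/-- Entrywise derivative of the matrix inverse. -/
theorem inv_entry_deriv {N : ℕ} (X : ℝ → Matrix (Fin N) (Fin N) ℂ)
    (X' : Matrix (Fin N) (Fin N) ℂ) (x : ℝ) (hu : IsUnit (X x))
    (h : ∀ i j, HasDerivAt (fun t => X t i j) (X' i j) x) (i j : Fin N) :
    HasDerivAt (fun t => (X t)⁻¹ i j) ((-((X x)⁻¹ * X' * (X x)⁻¹)) i j) x := by
  have hX : HasDerivAt X X' x := by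
    have e : X = fun t => ∑ i, ∑ j, (X t i j) • Matrix.single i j (1:ℂ) := by
      funext t
      conv_lhs => rw [Matrix.matrix_eq_sum_single (X t)]
      simp [Matrix.smul_single]
    have e' : X' = ∑ i, ∑ j, (X' i j) • Matrix.single i j (1:ℂ) := by
      conv_lhs => rw [Matrix.matrix_eq_sum_single X']
      simp [Matrix.smul_single]
    rw [e, e']
    refine HasDerivAt.fun_sum fun i _ => HasDerivAt.fun_sum fun j _ => ?_
    let L : ℂ →L[ℝ] Matrix (Fin N) (Fin N) ℂ := LinearMap.toContinuousLinearMap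
      { toFun := fun c => c • Matrix.single i j (1:ℂ)
        map_add' := fun a b => add_smul a b _
        map_smul' := fun r a => by simp }
    exact L.hasFDerivAt.comp_hasDerivAt x (h i j)
  obtain ⟨u, hu⟩ := hu
  have hI := hasFDerivAt_ringInverse (𝕜 := ℝ) u
  rw [hu] at hI
  have hc := hI.comp_hasDerivAt x hX
  let E : Matrix (Fin N) (Fin N) ℂ →L[ℝ] ℂ := LinearMap.toContinuousLinearMap
      { toFun := fun M => M i j
        map_add' := fun a b => rfl
        map_smul' := fun r a => rfl }
  have := E.hasFDerivAt.comp_hasDerivAt x hc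
  have e1 : (fun t => (X t)⁻¹ i j) = E ∘ (Ring.inverse ∘ X) := by
    funext t
    rw [Matrix.nonsing_inv_eq_ringInverse]
    rfl
  rw [e1]
  refine this.congr_deriv ?_
  symm
  have : (X x)⁻¹ = ((u⁻¹ : (Matrix (Fin N) (Fin N) ℂ)ˣ) : Matrix (Fin N) (Fin N) ℂ) := by
    rw [← hu, Matrix.coe_units_inv]
  rw [this]
  change _ = ((-(ContinuousLinearMap.mulLeftRight ℝ (Matrix (Fin N) (Fin N) ℂ)) ↑u⁻¹ ↑u⁻¹) X') i j
  simp

end InvDeriv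

attribute [local instance] Matrix.normedAddCommGroup Matrix.normedSpace

/-- for a Sturm–Liouville vessel, `β(x) = −(B(x)* 𝕏(x)⁻¹ B(x))₁₁` is
differentiable and `β' = trace([[0,−i],[i,0]] B* 𝕏⁻¹ B) + β²`. -/
theorem beta_first_derivative (N : ℕ) (hN : 1 ≤ N)
    (A : Matrix (Fin N) (Fin N) ℂ)
    (B : ℝ → Matrix (Fin N) (Fin 2) ℂ)
    (X : ℝ → Matrix (Fin N) (Fin N) ℂ)
    (hBsmooth : ContDiff ℝ 1 B) (hXsmooth : ContDiff ℝ 1 X)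
    (hherm : ∀ x, (X x).IsHermitian) (hinv : ∀ x, IsUnit (X x))
    (h1 : ∀ x, HasDerivAt (fun x' => B x' * sigma1)
      (-(A * B x * sigma2 + B x * gammaM)) x)
    (h2 : ∀ x, A * X x + X x * Aᴴ + B x * sigma1 * (B x)ᴴ = 0)
    (h3 : ∀ x, HasDerivAt X (B x * sigma2 * (B x)ᴴ) x)
    (β : ℝ → ℂ) (hβ : ∀ x, β x = -(((B x)ᴴ * (X x)⁻¹ * B x) 0 0)) :
    ∀ x, HasDerivAt β
      (Matrix.trace (!![0, -Complex.I; Complex.I, 0] * ((B x)ᴴ * (X x)⁻¹ * B x)) + (β x) ^ 2)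
      x := by
  intro x
  have hX : ∀ i j, HasDerivAt (fun t => X t i j) ((B x * sigma2 * (B x)ᴴ) i j) x := fun i j =>
    hasDerivAt_pi.1 (hasDerivAt_pi.1 (h3 x) i) j
  have hY := inv_entry_deriv X _ x (hinv x) hX
  have hb : ∀ i, HasDerivAt (fun t => B t i 0) (-(Complex.I * B x i 1)) x := fun i => by
    have := hasDerivAt_pi.1 (hasDerivAt_pi.1 (h1 x) i) 1
    simpa [sigma1, sigma2, gammaM, Matrix.mul_apply, Fin.sum_univ_two, mul_comm] using this
  have hs : ∀ i, HasDerivAt (fun t => star (B t i 0)) (star (-(Complex.I * B x i 1))) x :=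
    fun i => (hb i).star
  have hβ' : β = fun t => -∑ j, (∑ i, star (B t i 0) * (X t)⁻¹ i j) * B t j 0 := by
    funext t
    rw [hβ t]
    simp [Matrix.mul_apply]
  have key := (HasDerivAt.fun_sum (u := Finset.univ) fun j _ =>
    (HasDerivAt.fun_sum (u := Finset.univ) fun i _ => (hs i).fun_mul (hY i j)).fun_mul (hb j)).fun_neg
  rw [← hβ'] at key
  refine key.congr_deriv ?_
  symm
  rw [hβ x]
  set Y := (X x)⁻¹ with hYdef
  have hsq : (((B x)ᴴ * Y * B x) 0 0) ^ 2
      = ((B x)ᴴ * (Y * (B x * sigma2 * (B x)ᴴ) * Y) * B x) 0 0 := by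
    have : (B x)ᴴ * (Y * (B x * sigma2 * (B x)ᴴ) * Y) * B x
        = ((B x)ᴴ * Y * B x) * sigma2 * ((B x)ᴴ * Y * B x) := by
      simp only [Matrix.mul_assoc]
    rw [this]
    generalize (B x)ᴴ * Y * B x = M
    simp [Matrix.mul_apply, sigma2, Fin.sum_univ_two, sq]
  rw [neg_sq, hsq]
  generalize Y * (B x * sigma2 * (B x)ᴴ) * Y = Z
  simp only [Matrix.trace_fin_two, Matrix.mul_apply, Fin.sum_univ_two, Matrix.neg_apply,
    Matrix.conjTranspose_apply]
  simp [Finset.sum_add_distrib, Finset.sum_mul, Finset.mul_sum, add_mul]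
  simp only [← Finset.sum_neg_distrib, ← Finset.sum_add_distrib]
  refine Finset.sum_congr rfl fun j _ => ?_
  refine Finset.sum_congr rfl fun i _ => ?_
  ring

end
end
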